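/- There exists no finite 5-regular matchstick graph. That is, there is no finite simple graph G = (V,E) in which every vertex has degree 5, together with an injective map g : V → ℝ² such that every edge of G joins points at Euclidean distance 1 and the closed segments of any two vertex-disjoint edges are disjoint. -/

import Mathlib

/-- A matchstick embedding of a simple graph `G` in the plane: an injective map
`g` of the vertices into `ℝ²` such that every edge joins points at Euclidean
distance `1`, and the closed segments of any two vertex-disjoint edges are
disjoint. -/
def IsMatchstickEmbedding {V : Type*} (G : SimpleGraph V)
    (g : V → EuclideanSpace ℝ (Fin 2)) : Prop :=
  Function.Injective g ∧
  (∀ i j : V, G.Adj i j → dist (g i) (g j) = 1) ∧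
  (∀ i₁ j₁ i₂ j₂ : V, G.Adj i₁ j₁ → G.Adj i₂ j₂ →
    ({i₁, j₁} : Set V) ∩ ({i₂, j₂} : Set V) = ∅ →
    segment ℝ (g i₁) (g j₁) ∩ segment ℝ (g i₂) (g j₂) = ∅)


namespace MSProof
open Classical

lemma fin_rot {α : Type} [Fintype α] (a : α → ℝ) (ha : Function.Injective a) :
    ∃ σ : Equiv.Perm α,
      (∀ d, (a d < a (σ d) ∧ ∀ e, a e ≤ a d ∨ a (σ d) ≤ a e) ∨
        ((∀ e, a e ≤ a d) ∧ ∀ e, a (σ d) ≤ a e)) ∧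
      (∀ P : α → Prop, (∀ d, P d → P (σ d)) → ∀ d e, P d → P e) := by
  let _ : LinearOrder α := LinearOrder.lift' a ha
  have hle : ∀ x y : α, x ≤ y ↔ a x ≤ a y := fun x y => Iff.rfl
  have hlt : ∀ x y : α, x < y ↔ a x < a y := fun x y => by
    rw [← not_le, ← not_le, hle]
  rcases hn : Fintype.card α with _ | n
  · have := Fintype.card_eq_zero_iff.mp hn
    exact ⟨1, fun d => isEmptyElim d, fun P _ d => isEmptyElim d⟩
  let f : Fin (n+1) ≃o α := Fintype.orderIsoFinOfCardEq α hn
  refine ⟨f.symm.toEquiv.trans ((finRotate (n+1)).trans f.toEquiv), ?_, ?_⟩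
  · intro d
    obtain ⟨i, rfl⟩ := f.surjective d
    have hs : (f.symm.toEquiv.trans ((finRotate (n+1)).trans f.toEquiv)) (f i)
        = f (finRotate (n+1) i) := by simp
    rw [hs]
    by_cases hi : i = Fin.last n
    · right
      subst hi
      rw [finRotate_last]
      constructor
      · intro e
        obtain ⟨j, rfl⟩ := f.surjective e
        rw [← hle, f.le_iff_le]; exact Fin.le_last _
      · intro e
        obtain ⟨j, rfl⟩ := f.surjective e
        rw [← hle, f.le_iff_le]; exact Fin.zero_le _
    · left
      have hi' : (i : ℕ) < n := by
        have := i.2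
        have h2 : (i : ℕ) ≠ n := fun h => hi (Fin.ext (by simpa using h))
        omega
      have hv : ((finRotate (n+1) i : Fin (n+1)) : ℕ) = i + 1 := by
        rw [coe_finRotate_of_ne_last hi]
      constructor
      · rw [← hlt, f.lt_iff_lt, Fin.lt_def, hv]; omega
      · intro e
        obtain ⟨j, rfl⟩ := f.surjective e
        rw [← hle, ← hle, f.le_iff_le, f.le_iff_le, Fin.le_def, Fin.le_def, hv]
        omega
  · intro P hP
    have hs : ∀ i, P (f i) → P (f (finRotate (n+1) i)) := by
      intro i hi
      have := hP _ hi
      simpa using this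
    have up : ∀ k : ℕ, ∀ i j : Fin (n+1), (j : ℕ) = i + k → P (f i) → P (f j) := by
      intro k
      induction k with
      | zero => intro i j h hi; have : j = i := Fin.ext (by simpa using h)
                rwa [this]
      | succ k ih =>
        intro i j h hi
        have hj := j.2
        have h1 := ih i ⟨i + k, by omega⟩ rfl hi
        have h2 := hs _ h1
        have hne : (⟨i + k, by omega⟩ : Fin (n+1)) ≠ Fin.last n := by
          intro h; have := congrArg Fin.val h; simp at this; omega
        have hv := coe_finRotate_of_ne_last hne
        have : finRotate (n+1) ⟨i + k, by omega⟩ = j := Fin.ext (by rw [hv]; simp; omega)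
        rwa [this] at h2
    intro d e hd
    obtain ⟨i, rfl⟩ := f.surjective d
    obtain ⟨j, rfl⟩ := f.surjective e
    have h1 : P (f (Fin.last n)) := up (n - i) i _ (by have := i.2; simp; omega) hd
    have h2 := hs _ h1
    rw [finRotate_last] at h2
    exact up j 0 j (by simp) h2

lemma exists_rot {α β : Type} [Fintype α] (p : α → β) (a : α → ℝ)
    (ha : ∀ d e, p d = p e → a d = a e → d = e) :
    ∃ σ : Equiv.Perm α, (∀ d, p (σ d) = p d) ∧
      (∀ d, (a d < a (σ d) ∧ ∀ e, p e = p d → a e ≤ a d ∨ a (σ d) ≤ a e) ∨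
        ((∀ e, p e = p d → a e ≤ a d) ∧ ∀ e, p e = p d → a (σ d) ≤ a e)) ∧
      (∀ P : α → Prop, (∀ d, P d → P (σ d)) → ∀ d e, p d = p e → P d → P e) := by
  have key : ∀ b : β, ∃ σ : Equiv.Perm {d // p d = b},
      (∀ d : {d // p d = b}, (a d < a (σ d) ∧ ∀ e : {d // p d = b}, a e ≤ a d ∨ a (σ d) ≤ a e) ∨
        ((∀ e : {d // p d = b}, a e ≤ a d) ∧ ∀ e : {d // p d = b}, a (σ d) ≤ a e)) ∧
      (∀ P : {d // p d = b} → Prop, (∀ d, P d → P (σ d)) → ∀ d e, P d → P e) := by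
    intro b
    exact fin_rot (fun d : {d // p d = b} => a d)
      (fun x y h => Subtype.ext (ha _ _ (x.2.trans y.2.symm) h))
  choose s h1 h2 using key
  refine ⟨(Equiv.sigmaFiberEquiv p).permCongr (Equiv.sigmaCongrRight s), ?_, ?_, ?_⟩
  all_goals
    have hv : ∀ d, (Equiv.sigmaFiberEquiv p).permCongr (Equiv.sigmaCongrRight s) d
      = (s (p d) ⟨d, rfl⟩ : α) := by
      intro d
      simp [Equiv.permCongr_apply, Equiv.sigmaFiberEquiv]
  · intro d; rw [hv]; exact (s (p d) ⟨d, rfl⟩).2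
  · intro d
    rw [hv]
    rcases h1 (p d) ⟨d, rfl⟩ with h | h
    · exact Or.inl ⟨h.1, fun e he => h.2 ⟨e, he⟩⟩
    · exact Or.inr ⟨fun e he => h.1 ⟨e, he⟩, fun e he => h.2 ⟨e, he⟩⟩
  · intro P hP d e hde hd
    refine h2 (p d) (fun x => P x) ?_ ⟨d, rfl⟩ ⟨e, hde.symm⟩ hd
    rintro ⟨x, hx⟩ hPx
    have := hP x hPx
    rw [hv] at this
    subst_vars
    have h3 : ∀ (b : β) (hb : p x = b), P (s (p x) ⟨x, rfl⟩ : α) → P (s b ⟨x, hb⟩ : α) := by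
      intro b hb; subst hb; exact id
    exact h3 _ hx this

end MSProof

namespace MSProof
open Classical

structure Cfg (V : Type) [Fintype V] where
  G : SimpleGraph V
  X : V → ℝ
  Y : V → ℝ
  injX : Function.Injective X
  unit : ∀ i j, G.Adj i j → (X j - X i) ^ 2 + (Y j - Y i) ^ 2 = 1
  nocross : ∀ a b c d, G.Adj a b → G.Adj c d → a ≠ c → a ≠ d → b ≠ c → b ≠ d →
    ∀ s t : ℝ, 0 ≤ s → s ≤ 1 → 0 ≤ t → t ≤ 1 →
      X a + s * (X b - X a) = X c + t * (X d - X c) →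
      Y a + s * (Y b - Y a) = Y c + t * (Y d - Y c) → False
  conn : G.Connected
  deg : ∀ v, (Finset.univ.filter (fun d : G.Dart => d.fst = v)).card = 5

namespace Cfg
variable {V : Type} [Fintype V] (K : Cfg V)

/-- darts going to the right -/
def R (d : K.G.Dart) : Prop := K.X d.fst < K.X d.snd

/-- slope -/
noncomputable def s (d : K.G.Dart) : ℝ := (K.Y d.snd - K.Y d.fst) / (K.X d.snd - K.X d.fst)

/-- direction angle -/
noncomputable def a (d : K.G.Dart) : ℝ :=
  if K.R d then Real.arctan (K.s d) else Real.arctan (K.s d) + Real.pi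

/-- height of supporting line -/
noncomputable def ht (d : K.G.Dart) (t : ℝ) : ℝ := K.Y d.fst + K.s d * (t - K.X d.fst)

lemma Xne (d : K.G.Dart) : K.X d.fst ≠ K.X d.snd := fun h => d.adj.ne (K.injX h)

lemma R_symm (d : K.G.Dart) : K.R d.symm ↔ ¬ K.R d := by
  have := K.Xne d
  simp only [R, SimpleGraph.Dart.symm, Prod.fst_swap, Prod.snd_swap, not_lt]
  exact ⟨le_of_lt, fun h => lt_of_le_of_ne h (Ne.symm this)⟩

lemma s_symm (d : K.G.Dart) : K.s d.symm = K.s d := by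
  have := K.Xne d
  simp only [s, SimpleGraph.Dart.symm, Prod.fst_swap, Prod.snd_swap]
  rw [← neg_sub (K.Y d.snd), ← neg_sub (K.X d.snd), neg_div_neg_eq]

lemma s_mul (d : K.G.Dart) : K.s d * (K.X d.snd - K.X d.fst) = K.Y d.snd - K.Y d.fst := by
  have := K.Xne d
  rw [s, div_mul_cancel₀]
  exact sub_ne_zero.mpr (Ne.symm this)

@[simp] lemma ht_fst (d : K.G.Dart) : K.ht d (K.X d.fst) = K.Y d.fst := by simp [ht]
@[simp] lemma ht_snd (d : K.G.Dart) : K.ht d (K.X d.snd) = K.Y d.snd := by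
  simp [ht, s_mul]
lemma ht_symm (d : K.G.Dart) (t : ℝ) : K.ht d.symm t = K.ht d t := by
  have := K.s_mul d
  simp only [ht, s_symm]
  simp only [SimpleGraph.Dart.symm, Prod.fst_swap]
  linear_combination - this

lemma a_symm (d : K.G.Dart) : K.a d.symm = K.a d + (if K.R d then Real.pi else - Real.pi) := by
  simp only [a, s_symm, R_symm]
  by_cases h : K.R d <;> simp [h]

lemma a_R {d : K.G.Dart} (h : K.R d) : K.a d < Real.pi / 2 := by
  simp only [a, h, if_true]; exact Real.arctan_lt_pi_div_two _
lemma a_L {d : K.G.Dart} (h : ¬ K.R d) : Real.pi / 2 < K.a d := by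
  simp only [a, h, if_false]; have := Real.neg_pi_div_two_lt_arctan (K.s d); linarith
lemma a_lt (d : K.G.Dart) : K.a d < 3 * Real.pi / 2 := by
  have := Real.arctan_lt_pi_div_two (K.s d)
  have := Real.pi_pos
  simp only [a]; split_ifs <;> linarith
lemma lt_a (d : K.G.Dart) : - (Real.pi / 2) < K.a d := by
  have := Real.neg_pi_div_two_lt_arctan (K.s d)
  have := Real.pi_pos
  simp only [a]; split_ifs <;> linarith

lemma a_lt_iff {d e : K.G.Dart} (h : K.R d ↔ K.R e) : K.a d < K.a e ↔ K.s d < K.s e := by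
  by_cases h1 : K.R d
  · have h2 := h.mp h1
    simp [a, h1, h2, Real.arctan_strictMono.lt_iff_lt]
  · have h2 : ¬ K.R e := fun h2 => h1 (h.mpr h2)
    simp [a, h1, h2, Real.arctan_strictMono.lt_iff_lt]
lemma a_le_iff {d e : K.G.Dart} (h : K.R d ↔ K.R e) : K.a d ≤ K.a e ↔ K.s d ≤ K.s e := by
  rw [← not_lt, ← not_lt, a_lt_iff K h.symm]

lemma dx_sq (d : K.G.Dart) : (K.X d.snd - K.X d.fst) ^ 2 * (1 + K.s d ^ 2) = 1 := by
  have h1 := K.unit _ _ d.adj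
  have h2 := K.s_mul d
  rw [← h2] at h1; linarith

lemma cos_a (d : K.G.Dart) : Real.cos (K.a d) = K.X d.snd - K.X d.fst := by
  have h1 := K.dx_sq d
  have hpos : 0 < 1 + K.s d ^ 2 := by positivity
  have hc : Real.cos (Real.arctan (K.s d)) = |K.X d.snd - K.X d.fst| := by
    rw [Real.cos_arctan, ← Real.sqrt_sq_eq_abs, ← Real.sqrt_one, ← Real.sqrt_div (by simp)]
    congr 1
    rw [Real.sqrt_one]
    field_simp; linarith
  by_cases h : K.R d
  · simp only [a, h, if_true, hc]
    exact abs_of_pos (sub_pos.mpr h)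
  · simp only [a, h, if_false, Real.cos_add_pi, hc]
    rw [abs_of_nonpos (by simpa [R] using h)]; ring

lemma sin_a (d : K.G.Dart) : Real.sin (K.a d) = K.Y d.snd - K.Y d.fst := by
  have h1 := K.cos_a d
  have h2 : Real.sin (K.a d) = K.s d * Real.cos (K.a d) := by
    have h3 : Real.sin (Real.arctan (K.s d)) = K.s d * Real.cos (Real.arctan (K.s d)) := by
      conv_rhs => rw [← Real.tan_arctan (K.s d)]
      rw [Real.tan_arctan, mul_comm]
      have := Real.tan_mul_cos (Real.cos_arctan_pos (K.s d)).ne'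
      rw [Real.tan_arctan] at this
      rw [← this]; ring
    by_cases h : K.R d
    · simp only [a, h, if_true, h3]
    · simp only [a, h, if_false, Real.cos_add_pi, Real.sin_add_pi, h3]; ring
  rw [h2, h1, s_mul]

lemma a_inj (d e : K.G.Dart) (h : d.fst = e.fst) (h2 : K.a d = K.a e) : d = e := by
  have h3 : K.X d.snd = K.X e.snd := by
    have h5 := K.cos_a d
    have h6 := K.cos_a e
    rw [h2, h6, h] at h5
    linarith
  exact SimpleGraph.Dart.ext _ _ (Prod.ext h (K.injX h3))

/-- The sign of the height difference of disjoint edges is constant. -/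
lemma const_sign {d e : K.G.Dart} (hd : K.R d) (he : K.R e)
    (h1 : d.fst ≠ e.fst) (h2 : d.fst ≠ e.snd) (h3 : d.snd ≠ e.fst) (h4 : d.snd ≠ e.snd)
    {t t' : ℝ} (a1 : K.X d.fst ≤ t) (a2 : t ≤ K.X d.snd) (a3 : K.X e.fst ≤ t)
    (a4 : t ≤ K.X e.snd)
    (b1 : K.X d.fst ≤ t') (b2 : t' ≤ K.X d.snd) (b3 : K.X e.fst ≤ t') (b4 : t' ≤ K.X e.snd)
    (h : K.ht d t < K.ht e t) : K.ht d t' < K.ht e t' := by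
  by_contra hc
  push Not at hc
  have hd' : 0 < K.X d.snd - K.X d.fst := sub_pos.mpr hd
  have he' : 0 < K.X e.snd - K.X e.fst := sub_pos.mpr he
  set H := fun u => K.ht e u - K.ht d u with hH
  have hden : 0 < H t - H t' := by simp only [hH]; linarith
  -- convex combination
  set l := H t / (H t - H t') with hl
  have hl0 : 0 ≤ l := div_nonneg (by simp only [hH]; linarith) hden.le
  have hl1 : l ≤ 1 := by rw [hl, div_le_one hden]; simp only [hH]; linarith
  set u := t + l * (t' - t) with hu
  have hz : K.ht e u = K.ht d u := by
    have h5 : l * (H t - H t') = H t := div_mul_cancel₀ _ hden.ne'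
    simp only [hH, ht] at h5
    simp only [ht, hu]
    linarith
  have hu1 : K.X d.fst ≤ u := by rw [hu]; nlinarith
  have hu2 : u ≤ K.X d.snd := by rw [hu]; nlinarith
  have hu3 : K.X e.fst ≤ u := by rw [hu]; nlinarith
  have hu4 : u ≤ K.X e.snd := by rw [hu]; nlinarith
  have f1 : (u - K.X d.fst) / (K.X d.snd - K.X d.fst) * (K.X d.snd - K.X d.fst)
    = u - K.X d.fst := div_mul_cancel₀ _ hd'.ne'
  have f2 : (u - K.X e.fst) / (K.X e.snd - K.X e.fst) * (K.X e.snd - K.X e.fst)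
    = u - K.X e.fst := div_mul_cancel₀ _ he'.ne'
  refine K.nocross _ _ _ _ d.adj e.adj h1 h2 h3 h4
    ((u - K.X d.fst) / (K.X d.snd - K.X d.fst)) ((u - K.X e.fst) / (K.X e.snd - K.X e.fst))
    (div_nonneg (by linarith) hd'.le) ((div_le_one hd').mpr (by linarith))
    (div_nonneg (by linarith) he'.le) ((div_le_one he').mpr (by linarith)) ?_ ?_
  · rw [f1, f2]; ring
  · rw [← K.s_mul d, ← K.s_mul e]
    simp only [ht] at hz
    linear_combination K.s d * f1 - K.s e * f2 - hz

lemma comb (xp xq xv xu : ℝ) (Q : ℝ → Prop) (h1 : xp < xq) (h2 : xv < xu)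
    (n1 : xp ≠ xv) (n2 : xp ≠ xu) (n3 : xq ≠ xv) (n4 : xq ≠ xu)
    (hQ : ∀ t t', xp ≤ t → t ≤ xq → xv ≤ t → t ≤ xu → xp ≤ t' → t' ≤ xq → xv ≤ t' → t' ≤ xu →
      Q t → Q t') :
    ((if xp < xv ∧ xv < xq ∧ Q xv then 1 else 0) - (if xp < xu ∧ xu < xq ∧ Q xu then 1 else 0)
    + (if xv < xp ∧ xp < xu ∧ Q xp then 1 else 0)
    - (if xv < xq ∧ xq < xu ∧ Q xq then 1 else 0) : ℝ) = 0 := by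
  have e1 : ∀ t t', xp ≤ t → t ≤ xq → xv ≤ t → t ≤ xu → xp ≤ t' → t' ≤ xq → xv ≤ t' → t' ≤ xu →
      (Q t ↔ Q t') := fun t t' a b c d e f g h =>
    ⟨hQ t t' a b c d e f g h, hQ t' t e f g h a b c d⟩
  rcases lt_or_gt_of_ne n1 with m1 | m1 <;> rcases lt_or_gt_of_ne n2 with m2 | m2 <;>
  rcases lt_or_gt_of_ne n3 with m3 | m3 <;> rcases lt_or_gt_of_ne n4 with m4 | m4 <;>
  simp only [m1, m2, m3, m4, m1.not_gt, m2.not_gt, m3.not_gt, m4.not_gt, true_and, false_and,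
    and_false, if_false] <;> (try (exfalso; linarith)) <;> (try norm_num)
  · rw [e1 xv xq] <;> linarith
  · rw [e1 xv xu] <;> linarith
  · rw [e1 xp xq] <;> linarith
  · rw [e1 xp xu] <;> linarith

end Cfg
end MSProof

namespace MSProof
open Classical
namespace Cfg
variable {V : Type} [Fintype V] (K : Cfg V)

structure IsCyc (z : K.G.Dart → ℝ) : Prop where
  anti : ∀ d, z d.symm = - z d
  cons : ∀ v, ∑ e : K.G.Dart, (if e.fst = v then 1 else 0) * z e = 0

/-- edge `e` (as right-going dart) passes strictly above `v` -/
def Ab (v : V) (e : K.G.Dart) : Prop :=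
  K.X e.fst < K.X v ∧ K.X v < K.X e.snd ∧ K.Y v < K.ht e (K.X v)

noncomputable def cf (d e : K.G.Dart) : ℝ :=
  (if K.Ab d.fst e then 1 else 0) + (if e.fst = d.fst ∧ K.R e then 1 else 0)
    - (if e.fst = d.fst ∧ K.a e ≤ K.a d then 1 else 0)

/-- winding number on the left of a dart -/
noncomputable def w (z : K.G.Dart → ℝ) (d : K.G.Dart) : ℝ := ∑ e, K.cf d e * z e

variable {K}

lemma IsCyc.sum_zero {z : K.G.Dart → ℝ} (hz : K.IsCyc z) (c : K.G.Dart → ℝ)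
    (hc : ∀ e, K.R e → c e = c e.symm) : ∑ e, c e * z e = 0 := by
  have hc' : ∀ e, c e = c e.symm := by
    intro e
    by_cases h : K.R e
    · exact hc e h
    · have := hc e.symm ((K.R_symm e).mpr h)
      rw [SimpleGraph.Dart.symm_symm] at this
      exact this.symm
  have h1 : ∑ e, c e * z e = ∑ e : K.G.Dart, c e.symm * z e.symm :=
    (Equiv.sum_comp (SimpleGraph.Dart.symm_involutive.toPerm) (fun e => c e * z e)).symm
  have h2 : ∑ e : K.G.Dart, c e.symm * z e.symm = - ∑ e, c e * z e := by
    rw [← Finset.sum_neg_distrib]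
    exact Finset.sum_congr rfl fun e _ => by rw [hz.anti, ← hc' e]; ring
  linarith

lemma ht_sub_fst (d e : K.G.Dart) (h : d.fst = e.fst) (t : ℝ) :
    K.ht e t - K.ht d t = (K.s e - K.s d) * (t - K.X d.fst) := by
  simp only [ht, h]; ring

lemma ht_snd' (d : K.G.Dart) (t : ℝ) : K.ht d t = K.Y d.snd + K.s d * (t - K.X d.snd) := by
  have := K.s_mul d
  simp only [ht]; linear_combination this

lemma ht_sub_snd (d e : K.G.Dart) (h : d.snd = e.snd) (t : ℝ) :
    K.ht e t - K.ht d t = (K.s d - K.s e) * (K.X d.snd - t) := by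
  rw [ht_snd' d, ht_snd' e, h]; ring

lemma dart_ext {d e : K.G.Dart} (h1 : d.fst = e.fst) (h2 : d.snd = e.snd) : d = e :=
  SimpleGraph.Dart.ext _ _ (Prod.ext h1 h2)

lemma s_ne_of_snd {d e : K.G.Dart} (hd : K.R d) (he : K.R e) (h : d.snd = e.snd) (hne : d ≠ e) :
    K.s d ≠ K.s e := by
  intro hs
  apply hne
  have : d.symm = e.symm := by
    apply K.a_inj _ _ h
    rw [a_symm, a_symm, if_pos hd, if_pos he]
    simp [a, hd, he, hs]
  have := congrArg SimpleGraph.Dart.symm this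
  simpa using this

/-- `p` is in the open vertical strip of `d` strictly above `d`. -/
def Wd (d : K.G.Dart) (p : V) : Prop :=
  K.X d.fst < K.X p ∧ K.X p < K.X d.snd ∧ K.ht d (K.X p) < K.Y p

lemma core {d e : K.G.Dart} (hd : K.R d) (he : K.R e) :
    ((if K.Ab d.fst e then 1 else 0) + (if e.fst = d.fst ∧ K.s d < K.s e then 1 else 0)
    + (if e = d then 1 else 0)
    - (if K.Ab d.snd e then 1 else 0) - (if e.snd = d.snd ∧ K.s e ≤ K.s d then 1 else 0)
    + (if Wd d e.fst then 1 else 0) - (if Wd d e.snd then 1 else 0) : ℝ) = 0 := by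
  have hd' : K.X d.fst < K.X d.snd := hd
  have he' : K.X e.fst < K.X e.snd := he
  by_cases hed : e = d
  · subst hed
    simp [Ab, Wd]
  by_cases h1 : e.fst = d.fst
  · have h2 : e.snd ≠ d.snd := fun h => hed (dart_ext h1 h)
    have h3 : K.X e.snd ≠ K.X d.snd := fun h => h2 (K.injX h)
    have hq := ht_sub_fst d e h1.symm (K.X e.snd)
    have hu := ht_sub_fst d e h1.symm (K.X d.snd)
    rw [ht_snd] at hq hu
    have n1 : ¬ K.Ab d.fst e := by simp [Ab, h1]
    have n2 : ¬ Wd d d.fst := by simp [Wd]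
    simp only [n1, n2, hed, h1, h2, if_false, true_and, false_and]
    have f1 : K.Ab d.snd e ↔ K.X d.snd < K.X e.snd ∧ K.s d < K.s e := by
      simp only [Ab, h1, hd', true_and]
      refine and_congr_right fun _ => ?_
      rw [← sub_pos, hu, mul_pos_iff_of_pos_right (by linarith), sub_pos]
    have f2 : Wd d e.snd ↔ K.X e.snd < K.X d.snd ∧ K.s d < K.s e := by
      have : K.X d.fst < K.X e.snd := by rw [← h1]; exact he'
      simp only [Wd, this, true_and]
      refine and_congr_right fun _ => ?_
      rw [← sub_pos, hq, mul_pos_iff_of_pos_right (by linarith), sub_pos]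
    simp only [f1, f2]
    rcases lt_or_gt_of_ne h3 with h | h <;> simp [h, h.not_gt]
  by_cases h2 : e.snd = d.snd
  · have h3 : K.X e.fst ≠ K.X d.fst := fun h => h1 (K.injX h)
    have hs := s_ne_of_snd he hd h2 hed
    have hq := ht_sub_snd d e h2.symm (K.X e.fst)
    have hu := ht_sub_snd d e h2.symm (K.X d.fst)
    rw [ht_fst] at hq hu
    have n1 : ¬ K.Ab d.snd e := by simp [Ab, h2]
    have n2 : ¬ Wd d d.snd := by simp [Wd]
    simp only [n1, n2, hed, h1, h2, if_false, true_and, false_and]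
    have f1 : K.Ab d.fst e ↔ K.X e.fst < K.X d.fst ∧ K.s e < K.s d := by
      simp only [Ab, h2, hd', true_and]
      refine and_congr_right fun _ => ?_
      rw [← sub_pos, hu, mul_pos_iff_of_pos_right (by linarith), sub_pos]
    have f2 : Wd d e.fst ↔ K.X d.fst < K.X e.fst ∧ K.s e < K.s d := by
      have : K.X e.fst < K.X d.snd := by rw [← h2]; exact he'
      simp only [Wd, this, true_and]
      refine and_congr_right fun _ => ?_
      rw [← sub_pos, hq, mul_pos_iff_of_pos_right (by linarith), sub_pos]
    have f3 : K.s e ≤ K.s d ↔ K.s e < K.s d := ⟨fun h => lt_of_le_of_ne h hs, le_of_lt⟩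
    simp only [f1, f2, f3]
    rcases lt_or_gt_of_ne h3 with h | h <;> simp [h, h.not_gt]
  simp only [hed, h1, h2, if_false, false_and]
  by_cases h3 : e.fst = d.snd
  · have n1 : ¬ K.Ab d.fst e := by simp [Ab, h3, hd'.le]
    have n2 : ¬ K.Ab d.snd e := by simp [Ab, h3]
    have n3 : ¬ Wd d e.fst := by simp [Wd, h3]
    have n4 : ¬ Wd d e.snd := by
      intro h; have := h.2.1; rw [h3] at he'; linarith
    simp [n1, n2, n3, n4]
  by_cases h4 : e.snd = d.fst
  · have n1 : ¬ K.Ab d.fst e := by simp [Ab, h4]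
    have n2 : ¬ K.Ab d.snd e := by simp [Ab, h4, hd'.le]
    have n3 : ¬ Wd d e.snd := by simp [Wd, h4]
    have n4 : ¬ Wd d e.fst := by
      intro h; have := h.1; rw [h4] at he'; linarith
    simp [n1, n2, n3, n4]
  have := comb (K.X e.fst) (K.X e.snd) (K.X d.fst) (K.X d.snd)
    (fun t => K.ht d t < K.ht e t) he' hd' (fun h => h1 (K.injX h)) (fun h => h3 (K.injX h))
    (fun h => h4 (K.injX h)) (fun h => h2 (K.injX h))
    (fun t t' a1 a2 a3 a4 b1 b2 b3 b4 h =>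
      K.const_sign hd he (Ne.symm h1) (Ne.symm h4) (Ne.symm h3) (Ne.symm h2)
        a3 a4 a1 a2 b3 b4 b1 b2 h)
  simp only [ht_fst, ht_snd] at this
  have q1 : K.Ab d.fst e = (K.X e.fst < K.X d.fst ∧ K.X d.fst < K.X e.snd ∧
    K.Y d.fst < K.ht e (K.X d.fst)) := rfl
  have q2 : K.Ab d.snd e = (K.X e.fst < K.X d.snd ∧ K.X d.snd < K.X e.snd ∧
    K.Y d.snd < K.ht e (K.X d.snd)) := rfl
  have q3 : Wd d e.fst = (K.X d.fst < K.X e.fst ∧ K.X e.fst < K.X d.snd ∧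
    K.ht d (K.X e.fst) < K.Y e.fst) := rfl
  have q4 : Wd d e.snd = (K.X d.fst < K.X e.snd ∧ K.X e.snd < K.X d.snd ∧
    K.ht d (K.X e.snd) < K.Y e.snd) := rfl
  simp only [← q1, ← q2, ← q3, ← q4] at this
  simp only [add_zero, sub_zero]
  convert this

lemma IsCyc.w_symm_R {z : K.G.Dart → ℝ} (hz : K.IsCyc z) {d : K.G.Dart} (hd : K.R d) :
    K.w z d.symm = K.w z d + z d := by
  have h1 : ∑ p : V, (if Wd d p then 1 else 0) *
      ∑ e : K.G.Dart, (if e.fst = p then 1 else 0) * z e = 0 := by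
    simp only [hz.cons, mul_zero, Finset.sum_const_zero]
  have h2 : ∑ e : K.G.Dart, (if Wd d e.fst then 1 else 0) * z e = 0 := by
    refine Eq.trans ?_ h1
    simp_rw [Finset.mul_sum]
    rw [Finset.sum_comm]
    refine Finset.sum_congr rfl fun e _ => ?_
    rw [Finset.sum_eq_single e.fst]
    · simp
    · intro b _ hb; simp [Ne.symm hb]
    · simp
  have h3 := hz.sum_zero (fun e => K.cf d e + (if e = d then 1 else 0) - K.cf d.symm e
      + (if Wd d e.fst then 1 else 0)) ?_
  · have h4 : ∑ e : K.G.Dart, (if e = d then 1 else 0) * z e = z d := by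
      simp
    simp only [add_mul, sub_mul, Finset.sum_add_distrib, Finset.sum_sub_distrib] at h3
    rw [h4, h2] at h3
    simp only [w]
    linarith
  · intro e he
    have hc := core hd he
    have hd' : K.X d.fst < K.X d.snd := hd
    have he' : K.X e.fst < K.X e.snd := he
    have hnd : ¬ K.R d.symm := fun h => (K.R_symm d).mp h hd
    have hne : ¬ K.R e.symm := fun h => (K.R_symm e).mp h he
    have a1 := K.a_R hd
    have a2 := K.a_R he
    have a3 := K.a_L hnd
    have a4 := K.a_L hne
    have b1 : K.a e ≤ K.a d ↔ ¬ K.s d < K.s e := by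
      rw [K.a_le_iff (by simp [hd, he]), not_lt]
    have b2 : K.a e ≤ K.a d.symm := by linarith
    have b3 : ¬ K.a e.symm ≤ K.a d := by linarith
    have b4 : K.a e.symm ≤ K.a d.symm ↔ K.s e ≤ K.s d := by
      rw [K.a_le_iff (by simp [hnd, hne]), s_symm, s_symm]
    have c1 : ∀ v, ¬ K.Ab v e.symm := by
      intro v h
      have h1 : K.X e.snd < K.X v := h.1
      have h2 : K.X v < K.X e.fst := h.2.1
      linarith
    have c2 : e.symm ≠ d := fun h => hne (h ▸ hd)
    have s1 : e.symm.fst = e.snd := rfl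
    have s2 : d.symm.fst = d.snd := rfl
    simp only [cf, b1, b2, b3, b4, c1, c2, he, hne, s1, s2, and_true, and_false, if_false]
    have q : (if e.fst = d.fst ∧ K.s d < K.s e then (1:ℝ) else 0)
      = (if e.fst = d.fst then 1 else 0) - (if e.fst = d.fst ∧ ¬ K.s d < K.s e then 1 else 0) := by
      by_cases h : e.fst = d.fst <;> by_cases h' : K.s d < K.s e <;> simp [h, h']
    rw [q] at hc
    linarith

lemma IsCyc.w_symm {z : K.G.Dart → ℝ} (hz : K.IsCyc z) (d : K.G.Dart) :
    K.w z d.symm = K.w z d + z d := by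
  by_cases hd : K.R d
  · exact hz.w_symm_R hd
  · have := hz.w_symm_R ((K.R_symm d).mpr hd)
    rw [SimpleGraph.Dart.symm_symm, hz.anti] at this
    linarith

end Cfg
end MSProof

namespace MSProof
open Classical
namespace Cfg
variable {V : Type} [Fintype V] (K : Cfg V)

/-- rotation system -/
noncomputable def sg : Equiv.Perm K.G.Dart :=
  (exists_rot (fun d : K.G.Dart => d.fst) K.a K.a_inj).choose

lemma sg_fst (d : K.G.Dart) : (K.sg d).fst = d.fst :=
  (exists_rot (fun d : K.G.Dart => d.fst) K.a K.a_inj).choose_spec.1 d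

lemma sg_ind (P : K.G.Dart → Prop) (hP : ∀ d, P d → P (K.sg d)) (d e : K.G.Dart)
    (h : d.fst = e.fst) (hd : P d) : P e :=
  (exists_rot (fun d : K.G.Dart => d.fst) K.a K.a_inj).choose_spec.2.2 P hP d e h hd

/-- maximal angle at its vertex -/
def mx (d : K.G.Dart) : Prop := ∀ e : K.G.Dart, e.fst = d.fst → K.a e ≤ K.a d

lemma sg_not_mx {d : K.G.Dart} (h : ¬ K.mx d) :
    K.a d < K.a (K.sg d) ∧ ∀ e : K.G.Dart, e.fst = d.fst → K.a e ≤ K.a d ∨ K.a (K.sg d) ≤ K.a e := by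
  rcases (exists_rot (fun d : K.G.Dart => d.fst) K.a K.a_inj).choose_spec.2.1 d with h1 | h1
  · exact h1
  · exact absurd h1.1 h

lemma sg_mx {d : K.G.Dart} (h : K.mx d) : ∀ e : K.G.Dart, e.fst = d.fst → K.a (K.sg d) ≤ K.a e := by
  rcases (exists_rot (fun d : K.G.Dart => d.fst) K.a K.a_inj).choose_spec.2.1 d with h1 | h1
  · exact absurd (h _ (K.sg_fst d)) (not_le.mpr h1.1)
  · exact h1.2

lemma sg_ne (d : K.G.Dart) : K.sg d ≠ d := by
  intro h
  have h1 : ∀ e : K.G.Dart, e.fst = d.fst → e = d := fun e he =>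
    K.sg_ind (fun x => x = d) (fun x hx => by rw [hx, h]) d e he.symm rfl
  have h2 := K.deg d.fst
  have h3 : (Finset.univ.filter (fun e : K.G.Dart => e.fst = d.fst)) ⊆ {d} := by
    intro e he
    simp at he ⊢
    exact h1 e he
  have := Finset.card_le_card h3
  simp at this
  omega

/-- reversal -/
def rv : Equiv.Perm K.G.Dart := SimpleGraph.Dart.symm_involutive.toPerm

lemma rv_apply (d : K.G.Dart) : K.rv d = d.symm := rfl

/-- face permutation -/
noncomputable def ph : Equiv.Perm K.G.Dart := K.sg.trans K.rv

lemma ph_apply (d : K.G.Dart) : K.ph d = (K.sg d).symm := rfl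

lemma ph_symm (d : K.G.Dart) : (K.ph d).symm = K.sg d := by
  rw [ph_apply, SimpleGraph.Dart.symm_symm]

lemma ph_snd (d : K.G.Dart) : (K.ph d).snd = d.fst := K.sg_fst d

variable {K}

lemma IsCyc.w_ph {z : K.G.Dart → ℝ} (hz : K.IsCyc z) (d : K.G.Dart) :
    K.w z (K.ph d) = K.w z d := by
  rw [ph_apply, hz.w_symm]
  have key : ∀ e, K.cf (K.sg d) e = K.cf d e - (if e = K.sg d then 1 else 0)
      + (if K.mx d then 1 else 0) * (if e.fst = d.fst then 1 else 0) := by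
    intro e
    simp only [cf, sg_fst]
    by_cases h : e.fst = d.fst
    · have hinj : ∀ x : K.G.Dart, x.fst = d.fst → K.a e = K.a x → e = x :=
        fun x hx => K.a_inj e x (h.trans hx.symm)
      by_cases hm : K.mx d
      · have h1 := K.sg_mx hm e h
        have h2 := hm e h
        have h3 : K.a e ≤ K.a (K.sg d) ↔ e = K.sg d :=
          ⟨fun h4 => hinj _ (K.sg_fst d) (le_antisymm h4 h1), fun h4 => by rw [← h4]⟩
        simp only [h, h2, h3, hm, true_and, if_true]
        ring
      · obtain ⟨h1, h2⟩ := K.sg_not_mx hm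
        have h2 := h2 e h
        by_cases h4 : e = K.sg d
        · have h5 : ¬ K.a (K.sg d) ≤ K.a d := not_le.mpr h1
          have h6 : (K.sg d).fst = d.fst := K.sg_fst d
          simp only [h4, h6, h5, hm, true_and, if_true, le_refl, if_false]
          ring
        · have h5 : K.a e ≤ K.a (K.sg d) ↔ K.a e ≤ K.a d := by
            constructor
            · intro h6
              rcases h2 with h2 | h2
              · exact h2
              · exact absurd (hinj _ (K.sg_fst d) (le_antisymm h6 h2)) h4
            · intro h6; linarith
          simp only [h, h4, h5, hm, true_and, if_true, if_false]
          ring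
    · have h4 : e ≠ K.sg d := fun h4 => h (by rw [h4, sg_fst])
      simp [h, h4]
  simp only [w, key]
  simp only [add_mul, sub_mul, Finset.sum_add_distrib, Finset.sum_sub_distrib, mul_assoc,
    ← Finset.mul_sum, hz.cons]
  simp

variable (K)

/-- faces -/
def Face : Type := Quotient (Equiv.Perm.SameCycle.setoid K.ph)

noncomputable instance : Fintype K.Face := by unfold Face; infer_instance

noncomputable def fc (d : K.G.Dart) : K.Face := Quotient.mk (Equiv.Perm.SameCycle.setoid K.ph) d

lemma fc_surj : Function.Surjective K.fc := Quotient.mk_surjective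

lemma fc_eq {d e : K.G.Dart} : K.fc d = K.fc e ↔ K.ph.SameCycle d e := by
  exact Quotient.eq (r := Equiv.Perm.SameCycle.setoid K.ph)

lemma fc_ph (d : K.G.Dart) : K.fc (K.ph d) = K.fc d := by
  rw [fc_eq]; exact Equiv.Perm.sameCycle_apply_left.mpr (Equiv.Perm.SameCycle.refl _ _)

lemma inv_of_ph {β : Type} (F : K.G.Dart → β) (h : ∀ d, F (K.ph d) = F d) {d e : K.G.Dart}
    (hde : K.fc d = K.fc e) : F d = F e := by
  rw [fc_eq] at hde
  obtain ⟨n, hn⟩ := hde.exists_nat_pow_eq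
  rw [← hn]
  clear hn
  induction n with
  | zero => simp
  | succ n ih => rw [pow_succ', Equiv.Perm.mul_apply, h, ← ih]

abbrev RD := {d : K.G.Dart // K.R d}

noncomputable def ex (c : K.RD → ℝ) (d : K.G.Dart) : ℝ :=
  if h : K.R d then c ⟨d, h⟩ else - c ⟨d.symm, (K.R_symm d).mpr h⟩

lemma ex_anti (c : K.RD → ℝ) (d : K.G.Dart) : K.ex c d.symm = - K.ex c d := by
  by_cases h : K.R d
  · have h' : ¬ K.R d.symm := fun h2 => (K.R_symm d).mp h2 h
    simp [ex, h, h']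
  · have h' := (K.R_symm d).mpr h
    simp [ex, h, h']

noncomputable def MM : (K.Face → ℝ) →ₗ[ℝ] (K.RD → ℝ) where
  toFun f := fun d => f (K.fc d.1) - f (K.fc d.1.symm)
  map_add' f g := by ext d; simp; ring
  map_smul' r f := by ext d; simp; ring

noncomputable def bd : (K.RD → ℝ) →ₗ[ℝ] (V → ℝ) where
  toFun c := fun v => ∑ e : K.G.Dart, (if e.fst = v then 1 else 0) * K.ex c e
  map_add' f g := by
    ext v
    simp only [Pi.add_apply, ← Finset.sum_add_distrib]
    refine Finset.sum_congr rfl fun e _ => ?_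
    simp only [ex]; split_ifs <;> simp <;> ring
  map_smul' r f := by
    ext v
    simp only [Pi.smul_apply, smul_eq_mul, Finset.mul_sum, RingHom.id_apply]
    refine Finset.sum_congr rfl fun e _ => ?_
    simp only [ex]; split_ifs <;> simp

lemma ker_le : LinearMap.ker K.bd ≤ LinearMap.range K.MM := by
  intro c hc
  have hz : K.IsCyc (K.ex c) := ⟨K.ex_anti c, fun v => congrFun hc v⟩
  refine ⟨fun q => - K.w (K.ex c) (Function.surjInv K.fc_surj q), ?_⟩
  ext ⟨d, hd⟩
  have h : ∀ e, K.w (K.ex c) (Function.surjInv K.fc_surj (K.fc e)) = K.w (K.ex c) e := fun e =>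
    K.inv_of_ph _ hz.w_ph (Function.surjInv_eq K.fc_surj _)
  have hM : ∀ f, K.MM f ⟨d, hd⟩ = f (K.fc d) - f (K.fc d.symm) := fun f => rfl
  rw [hM]
  rw [h, h, hz.w_symm]
  simp [ex, hd]

lemma dart_card : Fintype.card K.G.Dart = 5 * Fintype.card V := by
  rw [← Finset.card_univ, Finset.card_eq_sum_card_fiberwise (f := fun d : K.G.Dart => d.fst)
    (t := Finset.univ) (fun _ _ => Finset.mem_coe.mpr (Finset.mem_univ _))]
  rw [Finset.sum_congr rfl (fun v _ => K.deg v)]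
  simp [mul_comm]

lemma RD_card : 2 * Fintype.card K.RD = 5 * Fintype.card V := by
  have h0 := K.dart_card
  have h1 : Fintype.card K.RD = Fintype.card {d : K.G.Dart // ¬ K.R d} := by
    refine Fintype.card_congr (K.rv.subtypeEquiv fun d => ?_)
    rw [rv_apply, R_symm, not_not]
  have := Fintype.card_subtype_compl (fun d => K.R d)
  have h3 := Fintype.card_subtype_le (fun d => K.R d)
  have h2 : Fintype.card K.RD = Fintype.card {d // K.R d} := rfl
  omega

lemma exists_dart (v : V) : ∃ d : K.G.Dart, d.fst = v := by
  have h2 := K.deg v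
  by_contra hc
  push Not at hc
  rw [Finset.filter_eq_empty_iff.mpr (fun d _ => hc d)] at h2
  simp at h2

lemma euler : Fintype.card K.RD + 1 ≤ Fintype.card V + Fintype.card K.Face := by
  have h1 := LinearMap.finrank_range_add_finrank_ker K.bd
  have h2 := LinearMap.finrank_range_add_finrank_ker K.MM
  have h3 := Submodule.finrank_mono K.ker_le
  have h4 := Submodule.finrank_le (LinearMap.range K.bd)
  rw [Module.finrank_fintype_fun_eq_card] at h1 h2 h4
  have h5 : 0 < Module.finrank ℝ (LinearMap.ker K.MM) := by
    have : Nonempty V := K.conn.nonempty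
    obtain ⟨d, -⟩ := K.exists_dart (Classical.arbitrary V)
    have hmem : (fun _ => 1 : K.Face → ℝ) ∈ LinearMap.ker K.MM := by
      ext d; simp [MM]
    rw [Module.finrank_pos_iff_exists_ne_zero]
    refine ⟨⟨_, hmem⟩, fun h => ?_⟩
    have := congrFun (congrArg Subtype.val h) (K.fc d)
    simp at this
  omega

end Cfg
end MSProof

namespace MSProof
open Classical
namespace Cfg
variable {V : Type} [Fintype V] (K : Cfg V)

noncomputable def zf (f : K.Face) (d : K.G.Dart) : ℝ :=
  (if K.fc d.symm = f then 1 else 0) - (if K.fc d = f then 1 else 0)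

lemma zf_cyc (f : K.Face) : K.IsCyc (K.zf f) := by
  constructor
  · intro d; simp [zf]
  · intro v
    simp only [zf, mul_sub, Finset.sum_sub_distrib]
    rw [sub_eq_zero, ← Equiv.sum_comp K.sg]
    refine Finset.sum_congr rfl fun e _ => ?_
    rw [sg_fst, ← ph_apply, fc_ph]

lemma const_of_inv {β : Type} (h : K.G.Dart → β) (h1 : ∀ d, h (K.ph d) = h d)
    (h2 : ∀ d : K.G.Dart, h d.symm = h d) (d e : K.G.Dart) : h d = h e := by
  have h3 : ∀ d, h (K.sg d) = h d := fun d => by rw [← ph_symm, h2, h1]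
  have h4 : ∀ d e : K.G.Dart, d.fst = e.fst → h d = h e := fun d e hde =>
    K.sg_ind (fun x => h d = h x) (fun x hx => by rw [h3, hx]) d e hde rfl
  have h5 : ∀ u v : V, K.G.Walk u v → ∀ d e : K.G.Dart, d.fst = u → e.fst = v → h d = h e := by
    intro u v p
    induction p with
    | nil => intro d e hd he; exact h4 d e (hd.trans he.symm)
    | cons hadj p ih =>
      rename_i x y zz
      intro d e hd he
      have e1 : h d = h (SimpleGraph.Dart.mk (x, y) hadj) := h4 _ _ hd
      rw [e1, ← h2]
      exact ih _ e rfl he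
  obtain ⟨p⟩ := K.conn.preconnected d.fst e.fst
  exact h5 _ _ p d e rfl rfl

/-- inner face -/
def Inner (f : K.Face) : Prop := ∀ d, K.w (K.zf f) d = if K.fc d = f then 1 else 0

lemma exists_f0 : ∃ f0 : K.Face, ∀ f, f ≠ f0 → K.Inner f := by
  have : Nonempty V := K.conn.nonempty
  obtain ⟨v0, -, hv0⟩ := Finset.exists_min_image (Finset.univ : Finset V) K.X Finset.univ_nonempty
  obtain ⟨d1, hd1⟩ := K.exists_dart v0
  obtain ⟨d0, hd0, hmax⟩ := Finset.exists_max_image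
    (Finset.univ.filter (fun d : K.G.Dart => d.fst = v0)) K.a ⟨d1, by simp [hd1]⟩
  simp at hd0 hmax hv0
  refine ⟨K.fc d0, fun f hf d => ?_⟩
  have hz := K.zf_cyc f
  have hc := K.const_of_inv (fun d => K.w (K.zf f) d - (if K.fc d = f then 1 else 0))
    (fun d => by rw [hz.w_ph, fc_ph])
    (fun d => by rw [hz.w_symm]; simp only [zf]; ring) d d0
  have h0 : K.w (K.zf f) d0 = 0 := by
    apply Finset.sum_eq_zero
    intro e _
    have : K.cf d0 e = 0 := by
      have h1 : ¬ K.Ab d0.fst e := by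
        intro h; have := h.1; rw [hd0] at this; linarith [hv0 e.fst]
      by_cases h2 : e.fst = d0.fst
      · have h3 : K.R e := lt_of_le_of_ne (by rw [h2, hd0]; exact hv0 _) (K.Xne e)
        have h4 : K.a e ≤ K.a d0 := hmax e (h2.trans hd0)
        simp [cf, h1, h2, h3, h4]
      · simp [cf, h1, h2]
    rw [this, zero_mul]
  have h1 : (if K.fc d0 = f then (1:ℝ) else 0) = 0 := if_neg (fun h => hf h.symm)
  simp only [h0, h1] at hc
  linarith

def Be (v : V) (e : K.G.Dart) : Prop :=
  K.X e.fst < K.X v ∧ K.X v < K.X e.snd ∧ K.ht e (K.X v) < K.Y v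

lemma not_on (v : V) (e : K.G.Dart) (h1 : K.X e.fst < K.X v) (h2 : K.X v < K.X e.snd)
    (h3 : K.ht e (K.X v) = K.Y v) : False := by
  have hex : ∃ d : K.G.Dart, d.fst = v ∧ d.snd ≠ e.fst ∧ d.snd ≠ e.snd := by
    by_contra hc
    push Not at hc
    have hd := K.deg v
    have hle : (Finset.univ.filter (fun d : K.G.Dart => d.fst = v)).card
        ≤ ({e.fst, e.snd} : Finset V).card := by
      apply Finset.card_le_card_of_injOn (fun d => d.snd)
      · intro d hd
        simp at hd ⊢
        by_cases h : d.snd = e.fst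
        · exact Or.inl h
        · exact Or.inr (hc d hd h)
      · intro d hd d' hd' h
        simp at hd hd'
        exact dart_ext (hd.trans hd'.symm) h
    have := Finset.card_le_two (a := e.fst) (b := e.snd)
    omega
  obtain ⟨d, hd, n1, n2⟩ := hex
  have m1 : d.fst ≠ e.fst := by rintro h; rw [← h, hd] at h1; exact lt_irrefl _ h1
  have m2 : d.fst ≠ e.snd := by rintro h; rw [← h, hd] at h2; exact lt_irrefl _ h2
  have hpos : 0 < K.X e.snd - K.X e.fst := by linarith
  have f2 : (K.X v - K.X e.fst) / (K.X e.snd - K.X e.fst) * (K.X e.snd - K.X e.fst)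
    = K.X v - K.X e.fst := div_mul_cancel₀ _ hpos.ne'
  refine K.nocross _ _ _ _ d.adj e.adj m1 m2 n1 n2 0
    ((K.X v - K.X e.fst) / (K.X e.snd - K.X e.fst)) le_rfl zero_le_one
    (div_nonneg (by linarith) hpos.le) ((div_le_one hpos).mpr (by linarith)) ?_ ?_
  · rw [f2, hd]; ring
  · rw [hd, ← h3, ← K.s_mul e]
    simp only [ht]
    linear_combination - K.s e * f2

lemma wrap_edges {f : K.Face} (hf : K.Inner f) {d : K.G.Dart} (hd : K.fc d = f) (hm : K.mx d)
    (hs : K.R d ∨ K.R (K.ph d)) :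
    (∃ e, K.Ab d.fst e ∧ K.fc e.symm = f) ∧ (∃ e, K.Be d.fst e ∧ K.fc e = f) := by
  have hz := K.zf_cyc f
  have hside : (∀ e : K.G.Dart, e.fst = d.fst → K.R e) ∨
      (∀ e : K.G.Dart, e.fst = d.fst → ¬ K.R e) := by
    rcases hs with h | h
    · left
      intro e he
      by_contra hc
      have := hm e he
      have := K.a_R h
      have := K.a_L hc
      linarith
    · right
      intro e he hc
      rw [ph_apply, R_symm] at h
      have := K.sg_mx hm e he
      have := K.a_R hc
      have := K.a_L h
      linarith
  have hw := hf d
  rw [if_pos hd] at hw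
  have hA : ∑ e, (if K.Ab d.fst e then 1 else 0) * K.zf f e = 1 := by
    refine Eq.trans ?_ hw
    have h1 : ∃ k : ℝ, ∀ e, K.cf d e = (if K.Ab d.fst e then 1 else 0) +
        k * (if e.fst = d.fst then 1 else 0) := by
      rcases hside with h | h
      · refine ⟨0, fun e => ?_⟩
        by_cases h2 : e.fst = d.fst
        · simp [cf, h2, h e h2, hm e h2]
        · simp [cf, h2]
      · refine ⟨-1, fun e => ?_⟩
        by_cases h2 : e.fst = d.fst
        · simp [cf, h2, h e h2, hm e h2]; ring
        · simp [cf, h2]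
    obtain ⟨k, hk⟩ := h1
    simp only [w, hk, add_mul, Finset.sum_add_distrib, mul_assoc, ← Finset.mul_sum, hz.cons]
    simp
  have hB1 : ∑ e : K.G.Dart, (if K.X e.fst < K.X d.fst then 1 else 0) * K.zf f e = 0 := by
    have h1 : ∑ p : V, (if K.X p < K.X d.fst then 1 else 0) *
        ∑ e : K.G.Dart, (if e.fst = p then 1 else 0) * K.zf f e = 0 := by
      simp only [hz.cons, mul_zero, Finset.sum_const_zero]
    refine Eq.trans ?_ h1
    simp_rw [Finset.mul_sum]
    rw [Finset.sum_comm]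
    refine Finset.sum_congr rfl fun e _ => ?_
    rw [Finset.sum_eq_single e.fst]
    · simp
    · intro b _ hb; simp [Ne.symm hb]
    · simp
  have hB2 : ∑ e : K.G.Dart, (if e.snd = d.fst ∧ K.X e.fst < K.X d.fst then 1 else 0)
      * K.zf f e = 0 := by
    rcases hside with h | h
    · apply Finset.sum_eq_zero
      intro e _
      rw [if_neg, zero_mul]
      rintro ⟨h1, h2⟩
      have : K.X e.snd < K.X e.fst := h e.symm h1
      rw [h1] at this
      linarith
    · have h1 := hz.sum_zero (fun e => (if e.fst = d.fst then 1 else 0) +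
        (if e.snd = d.fst then 1 else 0)) (fun e _ => add_comm _ _)
      simp only [add_mul, Finset.sum_add_distrib, hz.cons, zero_add] at h1
      refine Eq.trans ?_ h1
      refine Finset.sum_congr rfl fun e _ => ?_
      by_cases h2 : e.snd = d.fst
      · have h3 : ¬ K.R e.symm := h e.symm h2
        rw [R_symm, not_not] at h3
        have h4 : K.X e.fst < K.X e.snd := h3
        rw [h2] at h4
        simp [h2, h4]
      · simp [h2]
  have hB3 := hz.sum_zero (fun e => (if K.Ab d.fst e then 1 else 0) +
    (if K.Be d.fst e then 1 else 0) + (if e.snd = d.fst ∧ K.X e.fst < K.X d.fst then 1 else 0)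
    - (if K.X e.fst < K.X d.fst then 1 else 0)) (by
      intro e he
      have he' : K.X e.fst < K.X e.snd := he
      have s1 : e.symm.fst = e.snd := rfl
      have s2 : e.symm.snd = e.fst := rfl
      have n1 : ¬ K.Ab d.fst e.symm := fun h => by
        have h1 := h.1; have h2 := h.2.1; rw [s1] at h1; rw [s2] at h2; linarith
      have n2 : ¬ K.Be d.fst e.symm := fun h => by
        have h1 := h.1; have h2 := h.2.1; rw [s1] at h1; rw [s2] at h2; linarith
      have n3 : ¬ (e.fst = d.fst ∧ K.X e.snd < K.X d.fst) := by
        rintro ⟨h1, h2⟩; rw [h1] at he'; linarith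
      simp only [n1, n2, n3, s1, s2, if_false]
      rcases lt_trichotomy (K.X e.snd) (K.X d.fst) with h | h | h
      · have m1 : ¬ K.Ab d.fst e := fun h1 => by linarith [h1.2.1]
        have m2 : ¬ K.Be d.fst e := fun h1 => by linarith [h1.2.1]
        have m3 : e.snd ≠ d.fst := fun h1 => by rw [h1] at h; exact lt_irrefl _ h
        simp [m1, m2, m3, h, he'.trans h]
      · have m1 : ¬ K.Ab d.fst e := fun h1 => by linarith [h1.2.1]
        have m2 : ¬ K.Be d.fst e := fun h1 => by linarith [h1.2.1]
        have m3 := K.injX h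
        rw [h] at he'
        simp [m1, m2, m3, he']
      · have m3 : e.snd ≠ d.fst := fun h1 => by rw [h1] at h; exact lt_irrefl _ h
        by_cases h5 : K.X e.fst < K.X d.fst
        · have := K.not_on d.fst e h5 h
          rcases lt_trichotomy (K.Y d.fst) (K.ht e (K.X d.fst)) with h6 | h6 | h6
          · simp [Ab, Be, h5, h, h6, m3, h6.not_gt, h.not_gt]
          · exact absurd h6.symm this
          · simp [Ab, Be, h5, h, h6, m3, h6.not_gt, h.not_gt]
        · simp [Ab, Be, h5, m3, h.not_gt])
  simp only [add_mul, sub_mul, Finset.sum_add_distrib, Finset.sum_sub_distrib, hA, hB1, hB2] at hB3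
  constructor
  · by_contra hc
    push Not at hc
    have : ∑ e, (if K.Ab d.fst e then 1 else 0) * K.zf f e ≤ 0 := by
      apply Finset.sum_nonpos
      intro e _
      by_cases h : K.Ab d.fst e
      · have := hc e h
        simp only [zf, this, if_false]
        split_ifs <;> norm_num
      · simp [h]
    linarith
  · by_contra hc
    push Not at hc
    have : 0 ≤ ∑ e, (if K.Be d.fst e then 1 else 0) * K.zf f e := by
      apply Finset.sum_nonneg
      intro e _
      by_cases h : K.Be d.fst e
      · have := hc e h
        simp only [zf, this, if_false]
        split_ifs <;> norm_num
      · simp [h]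
    linarith

end Cfg
end MSProof

namespace MSProof
open Classical
namespace Cfg
variable {V : Type} [Fintype V] (K : Cfg V)

/-- corner angle -/
noncomputable def th (d : K.G.Dart) : ℝ :=
  K.a (K.sg d) - K.a d + (if K.mx d then 2 * Real.pi else 0)

lemma th_pos (d : K.G.Dart) : 0 < K.th d := by
  unfold th
  by_cases h : K.mx d
  · simp only [h, if_true]
    linarith [K.lt_a (K.sg d), K.a_lt d]
  · simp only [h, if_false]
    linarith [(K.sg_not_mx h).1]

lemma a_sg_lt {d : K.G.Dart} (h : K.mx d) : K.a (K.sg d) < K.a d :=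
  lt_of_le_of_ne (K.sg_mx h d rfl) (fun h' => K.sg_ne d (K.a_inj _ _ (K.sg_fst d) h'))

lemma th_lt (d : K.G.Dart) : K.th d < 2 * Real.pi := by
  unfold th
  by_cases h : K.mx d
  · simp only [h, if_true]
    linarith [K.a_sg_lt h]
  · simp only [h, if_false]
    linarith [K.a_lt (K.sg d), K.lt_a d]

lemma th_eq (d : K.G.Dart) : K.th d = K.a (K.ph d) - K.a d
    + (if K.R (K.ph d) then Real.pi else - Real.pi) + (if K.mx d then 2 * Real.pi else 0) := by
  unfold th
  rw [ph_apply, a_symm, R_symm]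
  by_cases h : K.R (K.sg d) <;> simp [h] <;> ring

lemma cos_th (d : K.G.Dart) : Real.cos (K.th d) =
    - ((K.X d.snd - K.X d.fst) * (K.X (K.ph d).snd - K.X (K.ph d).fst)
      + (K.Y d.snd - K.Y d.fst) * (K.Y (K.ph d).snd - K.Y (K.ph d).fst)) := by
  have h : Real.cos (K.th d) = Real.cos (K.a (K.sg d) - K.a d) := by
    unfold th
    split_ifs
    · rw [Real.cos_add_two_pi]
    · rw [add_zero]
  rw [h, Real.cos_sub, cos_a, cos_a, sin_a, sin_a, ← ph_symm]
  simp only [SimpleGraph.Dart.symm, Prod.fst_swap, Prod.snd_swap]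
  ring

lemma sin_th (d : K.G.Dart) : Real.sin (K.th d) =
    (K.Y d.snd - K.Y d.fst) * (K.X (K.ph d).snd - K.X (K.ph d).fst)
      - (K.X d.snd - K.X d.fst) * (K.Y (K.ph d).snd - K.Y (K.ph d).fst) := by
  have h : Real.sin (K.th d) = Real.sin (K.a (K.sg d) - K.a d) := by
    unfold th
    split_ifs
    · rw [Real.sin_add_two_pi]
    · rw [add_zero]
  rw [h, Real.sin_sub, cos_a, cos_a, sin_a, sin_a, ← ph_symm]
  simp only [SimpleGraph.Dart.symm, Prod.fst_swap, Prod.snd_swap]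
  ring

lemma vertex_sum (v : V) : ∑ d ∈ Finset.univ.filter (fun d : K.G.Dart => d.fst = v), K.th d
    = 2 * Real.pi := by
  obtain ⟨d1, hd1⟩ := K.exists_dart v
  obtain ⟨d0, hd0, hmax⟩ := Finset.exists_max_image
    (Finset.univ.filter (fun d : K.G.Dart => d.fst = v)) K.a ⟨d1, by simp [hd1]⟩
  simp at hd0 hmax
  have hmx : ∀ d : K.G.Dart, d.fst = v → (K.mx d ↔ d = d0) := by
    intro d hd
    constructor
    · intro h
      exact K.a_inj _ _ (hd.trans hd0.symm) (le_antisymm (hmax d hd) (h d0 (hd0.trans hd.symm)))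
    · rintro rfl e he
      exact hmax e (he.trans hd)
  simp only [th, Finset.sum_add_distrib, Finset.sum_sub_distrib]
  have h1 : ∑ d ∈ Finset.univ.filter (fun d : K.G.Dart => d.fst = v), K.a (K.sg d)
      = ∑ d ∈ Finset.univ.filter (fun d : K.G.Dart => d.fst = v), K.a d := by
    rw [Finset.sum_filter, Finset.sum_filter,
      ← Equiv.sum_comp K.sg (fun d => if d.fst = v then K.a d else 0)]
    simp only [sg_fst]
  have h2 : ∑ d ∈ Finset.univ.filter (fun d : K.G.Dart => d.fst = v),
      (if K.mx d then 2 * Real.pi else 0) = 2 * Real.pi := by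
    rw [Finset.sum_eq_single d0]
    · rw [if_pos ((hmx d0 hd0).mpr rfl)]
    · intro b hb hb0
      simp at hb
      rw [if_neg (fun h => hb0 ((hmx b hb).mp h))]
    · intro h; simp [hd0] at h
  rw [h1, h2]; ring

lemma mx_LL {d : K.G.Dart} (h1 : ¬ K.R d) (h2 : ¬ K.R (K.ph d)) : K.mx d := by
  by_contra h
  rw [ph_apply, R_symm, not_not] at h2
  linarith [(K.sg_not_mx h).1, K.a_L h1, K.a_R h2]

lemma mx_RR {d : K.G.Dart} (h1 : K.R d) (h2 : K.R (K.ph d)) : ¬ K.mx d := by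
  intro h
  rw [ph_apply, R_symm] at h2
  linarith [K.a_sg_lt h, K.a_L h2, K.a_R h1]

lemma mx_slope {d : K.G.Dart} (h : K.mx d) (h2 : K.R d ↔ ¬ K.R (K.ph d)) :
    K.s (K.ph d) < K.s d := by
  have h3 := K.a_sg_lt h
  rw [K.a_lt_iff (by rw [h2, ph_apply, R_symm, not_not])] at h3
  rw [ph_apply, s_symm]; exact h3

lemma nb1 (d : K.G.Dart) : (K.ph d).fst ≠ d.fst := by
  have := (K.ph d).adj.ne
  rwa [ph_snd] at this

lemma nb2 (d : K.G.Dart) : (K.ph d).fst ≠ d.snd := by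
  intro h
  apply K.sg_ne d
  rw [← ph_symm]
  apply dart_ext
  · exact K.ph_snd d
  · exact h

noncomputable def fib (f : K.Face) : Finset K.G.Dart := Finset.univ.filter (fun d => K.fc d = f)

lemma mem_fib {f : K.Face} {d : K.G.Dart} : d ∈ K.fib f ↔ K.fc d = f := by simp [fib]

lemma fib_cyc (f : K.Face) : K.ph.IsCycleOn (K.fib f : Set K.G.Dart) := by
  constructor
  · refine ⟨fun d hd => ?_, K.ph.injective.injOn, fun d hd => ⟨K.ph.symm d, ?_, ?_⟩⟩
    · simp only [Finset.mem_coe, mem_fib] at hd ⊢; rw [fc_ph, hd]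
    · simp only [Finset.mem_coe, mem_fib] at hd ⊢
      rw [← K.fc_ph, Equiv.apply_symm_apply, hd]
    · simp
  · intro d hd e he
    simp only [Finset.mem_coe, mem_fib] at hd he
    exact K.fc_eq.mp (hd.trans he.symm)

lemma face_param {f : K.Face} (k : ℕ) [NeZero k] (hk : (K.fib f).card = k) :
    ∃ d : Fin k → K.G.Dart, (∀ i, K.fc (d i) = f) ∧ (∀ i, d (i + 1) = K.ph (d i)) ∧
      (∀ e, K.fc e = f → ∃ i, e = d i) ∧
      (∀ F : K.G.Dart → ℝ, ∑ e ∈ K.fib f, F e = ∑ i, F (d i)) ∧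
      (∀ i, K.X (d 0).fst ≤ K.X (d i).fst) := by
  have hcyc := K.fib_cyc f
  have hne : (K.fib f).Nonempty := by
    rw [← Finset.card_pos, hk]; exact Nat.pos_of_ne_zero (NeZero.ne k)
  obtain ⟨d0, hd0, hmin⟩ := Finset.exists_min_image (K.fib f) (fun d => K.X d.fst) hne
  have hpk := hcyc.pow_card_apply hd0
  rw [hk] at hpk
  have hmem : ∀ n : ℕ, K.fc ((K.ph ^ n) d0) = f := by
    intro n
    induction n with
    | zero => simpa using K.mem_fib.mp hd0
    | succ n ih => rw [pow_succ', Equiv.Perm.mul_apply, fc_ph, ih]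
  have hsurj : ∀ e, K.fc e = f → ∃ i : Fin k, e = (K.ph ^ (i : ℕ)) d0 := by
    intro e he
    obtain ⟨n, hn, h⟩ := hcyc.exists_pow_eq hd0 (K.mem_fib.mpr he)
    exact ⟨⟨n, hk ▸ hn⟩, h.symm⟩
  refine ⟨fun i => (K.ph ^ (i : ℕ)) d0, fun i => hmem _, ?_, hsurj, ?_, ?_⟩
  · intro i
    have h1 : ((i + 1 : Fin k) : ℕ) = ((i : ℕ) + 1) % k := by
      rw [Fin.val_add]
      simp
    show (K.ph ^ ((i + 1 : Fin k) : ℕ)) d0 = _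
    rw [h1, ← Equiv.Perm.mul_apply, ← pow_succ']
    rcases Nat.lt_or_ge (i + 1 : ℕ) k with h | h
    · rw [Nat.mod_eq_of_lt h]
    · have : (i : ℕ) + 1 = k := by have := i.isLt; omega
      rw [this, Nat.mod_self, pow_zero, hpk]; rfl
  · intro F
    have himg : K.fib f = Finset.univ.image (fun i : Fin k => (K.ph ^ (i : ℕ)) d0) := by
      ext e
      simp only [mem_fib, Finset.mem_image, Finset.mem_univ, true_and]
      constructor
      · intro h; obtain ⟨i, hi⟩ := hsurj e h; exact ⟨i, hi.symm⟩
      · rintro ⟨i, rfl⟩; exact hmem _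
    have hinj : Set.InjOn (fun i : Fin k => (K.ph ^ (i : ℕ)) d0) (Finset.univ : Finset (Fin k)) := by
      rw [← Finset.card_image_iff, ← himg, hk]; simp
    rw [himg, Finset.sum_image hinj]
  · intro i
    simpa using hmin _ (K.mem_fib.mpr (hmem i))

end Cfg
end MSProof

namespace MSProof
open Classical

structure Poly (k : ℕ) [NeZero k] where
  x : Fin k → ℝ
  y : Fin k → ℝ
  s : Fin k → ℝ
  R : Fin k → Prop
  M : Fin k → Prop
  hR : ∀ i, R i → x i < x (i - 1)
  hL : ∀ i, ¬ R i → x (i - 1) < x i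
  hs : ∀ i, s i * (x (i - 1) - x i) = y (i - 1) - y i
  hLL : ∀ i, ¬ R i → ¬ R (i + 1) → M i
  hRR : ∀ i, R i → R (i + 1) → ¬ M i
  hsl : ∀ i, M i → (R i ↔ ¬ R (i + 1)) → s (i + 1) < s i
  hA : ∀ i, M i → (R i ∨ R (i + 1)) → ∃ j, x (j - 1) < x i ∧ x i < x j ∧
    y i < y j + s j * (x i - x j)
  hB : ∀ i, M i → (R i ∨ R (i + 1)) → ∃ j, x j < x i ∧ x i < x (j - 1) ∧
    y j + s j * (x i - x j) < y i
  hl : ∀ i, x 0 ≤ x i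

lemma fin5_all {P : Fin 5 → Prop} : (∀ i, P i) ↔ P 0 ∧ P 1 ∧ P 2 ∧ P 3 ∧ P 4 := by
  simp [Fin.forall_fin_succ]
lemma fin5_ex {P : Fin 5 → Prop} : (∃ i, P i) ↔ P 0 ∨ P 1 ∨ P 2 ∨ P 3 ∨ P 4 := by
  simp [Fin.exists_fin_succ]
lemma fin4_all {P : Fin 4 → Prop} : (∀ i, P i) ↔ P 0 ∧ P 1 ∧ P 2 ∧ P 3 := by
  simp [Fin.forall_fin_succ]
lemma fin4_ex {P : Fin 4 → Prop} : (∃ i, P i) ↔ P 0 ∨ P 1 ∨ P 2 ∨ P 3 := by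
  simp [Fin.exists_fin_succ]
lemma fin3_all {P : Fin 3 → Prop} : (∀ i, P i) ↔ P 0 ∧ P 1 ∧ P 2 := by
  simp [Fin.forall_fin_succ]
lemma fin3_ex {P : Fin 3 → Prop} : (∃ i, P i) ↔ P 0 ∨ P 1 ∨ P 2 := by
  simp [Fin.exists_fin_succ]

noncomputable def bb (p : Prop) : ℝ := if p then 1 else 0
noncomputable def rr (p : Prop) : ℝ := if p then 1 else -1

lemma bb_le (p : Prop) : bb p ≤ 1 := by unfold bb; split_ifs <;> norm_num
lemma bb_t {p : Prop} (h : p) : bb p = 1 := if_pos h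
lemma bb_f {p : Prop} (h : ¬ p) : bb p = 0 := if_neg h
lemma rr_t {p : Prop} (h : p) : rr p = 1 := if_pos h
lemma rr_f {p : Prop} (h : ¬ p) : rr p = -1 := if_neg h

lemma bb_sum2 {p q r : Prop} (h1 : ¬ (p ∧ q)) (h2 : ¬ (p ∧ r)) (h3 : ¬ (q ∧ r)) :
    bb p + bb q + bb r ≤ 1 := by
  unfold bb
  by_cases hp : p <;> by_cases hq : q <;> by_cases hr : r <;> simp_all

namespace Poly

lemma first (k : ℕ) [NeZero k] (P : Poly k) : P.R 0 ∧ ¬ P.R 1 ∧ ¬ P.M 0 := by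
  have h1 : P.R 0 := by
    by_contra h
    have := P.hL 0 h
    linarith [P.hl (0 - 1)]
  refine ⟨h1, ?_, ?_⟩
  · intro h
    have := P.hR 1 h
    rw [sub_self] at this
    linarith [P.hl 1]
  · intro h
    obtain ⟨j, h2, -⟩ := P.hB 0 h (Or.inl h1)
    linarith [P.hl j]

lemma rng {a b t : ℝ} (h : (a ≤ t ∧ t ≤ b) ∨ (b ≤ t ∧ t ≤ a)) : (t - a) * (t - b) ≤ 0 := by
  rcases h with ⟨h1, h2⟩ | ⟨h1, h2⟩
  · exact mul_nonpos_of_nonneg_of_nonpos (by linarith) (by linarith)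
  · exact mul_nonpos_of_nonpos_of_nonneg (by linarith) (by linarith)

set_option maxHeartbeats 2000000 in
lemma five (P : Poly 5)
    (hC : ∀ i t t', (t - P.x i) * (t - P.x (i - 1)) ≤ 0 →
      (t - P.x (i + 2)) * (t - P.x (i + 1)) ≤ 0 →
      (t' - P.x i) * (t' - P.x (i - 1)) ≤ 0 →
      (t' - P.x (i + 2)) * (t' - P.x (i + 1)) ≤ 0 →
      P.y i + P.s i * (t - P.x i) < P.y (i + 2) + P.s (i + 2) * (t - P.x (i + 2)) →
      P.y i + P.s i * (t' - P.x i) < P.y (i + 2) + P.s (i + 2) * (t' - P.x (i + 2))) :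
    ∑ i, (rr (P.R i) + 2 * bb (P.M i)) ≤ 3 := by
  obtain ⟨r0, r1, m0⟩ := P.first
  obtain ⟨x, y, s, R, M, hR, hL, hs, hLL, hRR, hsl, hA, hB, hl⟩ := P
  simp only at *
  have e0 : (0 - 1 : Fin 5) = 4 := rfl
  have e1 : (1 - 1 : Fin 5) = 0 := rfl
  have e2 : (2 - 1 : Fin 5) = 1 := rfl
  have e3 : (3 - 1 : Fin 5) = 2 := rfl
  have e4 : (4 - 1 : Fin 5) = 3 := rfl
  have f0 : (0 + 1 : Fin 5) = 1 := rfl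
  have f1 : (1 + 1 : Fin 5) = 2 := rfl
  have f2 : (2 + 1 : Fin 5) = 3 := rfl
  have f3 : (3 + 1 : Fin 5) = 4 := rfl
  have f4 : (4 + 1 : Fin 5) = 0 := rfl
  have hC4 := hC 4
  have hC0 := hC 0
  rw [show (4 + 2 : Fin 5) = 1 from rfl, e4, f4] at hC4
  rw [show (0 + 2 : Fin 5) = 2 from rfl, e0, f0] at hC0
  clear hC
  simp only [fin5_all, e0, e1, e2, e3, e4] at hR
  simp only [fin5_all, e0, e1, e2, e3, e4] at hL
  simp only [fin5_all, e0, e1, e2, e3, e4] at hs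
  simp only [fin5_all, f0, f1, f2, f3, f4] at hLL
  simp only [fin5_all, f0, f1, f2, f3, f4] at hRR
  simp only [fin5_all, f0, f1, f2, f3, f4] at hsl
  simp only [fin5_all, fin5_ex, e0, e1, e2, e3, e4, f0, f1, f2, f3, f4] at hA
  simp only [fin5_all, fin5_ex, e0, e1, e2, e3, e4, f0, f1, f2, f3, f4] at hB
  simp only [Fin.sum_univ_five]
  obtain ⟨R0, R1, R2, R3, R4⟩ := hR
  obtain ⟨L0, L1, L2, L3, L4⟩ := hL
  obtain ⟨s0, s1, s2, s3, s4⟩ := hs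
  obtain ⟨LL0, LL1, LL2, LL3, LL4⟩ := hLL
  obtain ⟨RR0, RR1, RR2, RR3, RR4⟩ := hRR
  obtain ⟨sl0, sl1, sl2, sl3, sl4⟩ := hsl
  obtain ⟨A0, A1, A2, A3, A4⟩ := hA
  obtain ⟨B0, B1, B2, B3, B4⟩ := hB
  have x04 := R0 r0
  have x01 := L1 r1
  rw [rr_t r0, rr_f r1, bb_f m0]
  by_cases r2 : R 2 <;> by_cases r3 : R 3 <;> by_cases r4 : R 4
  · -- RLRRR
    have := R2 r2
    have := R3 r3
    have := R4 r4
    have m1 : ¬ M 1 := fun h => by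
      rcases A1 h (Or.inr r2) with h | h | h | h | h <;> linarith [h.1, h.2.1]
    rw [rr_t r2, rr_t r3, rr_t r4, bb_f m1, bb_f (RR2 r2 r3), bb_f (RR3 r3 r4), bb_f (RR4 r4 r0)]
    norm_num
  · -- RLRRL
    have x21 := R2 r2
    have x32 := R3 r3
    have x34 := L4 r4
    have c1 : ¬ (M 1 ∧ M 4) := by
      rintro ⟨h1, h4⟩
      rcases A1 h1 (Or.inr r2) with h | h | h | h | h <;>
      rcases A4 h4 (Or.inr r0) with g | g | g | g | g <;>
      linarith [h.1, h.2.1, g.1, g.2.1]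
    have c2 : ¬ (M 3 ∧ M 4) := by
      rintro ⟨h3, h4⟩
      have hsl := sl4 h4 (by simp [r4, r0])
      rcases B3 h3 (Or.inl r3) with h | h | h | h | h <;> try linarith [h.1, h.2.1]
      linarith [h.2.2, mul_pos (sub_pos.mpr hsl) (sub_pos.mpr x34)]
    have c3 : ¬ (M 1 ∧ M 3) := by
      rintro ⟨h1, h3⟩
      rcases A1 h1 (Or.inr r2) with h | h | h | h | h <;> try linarith [h.1, h.2.1]
      rcases A3 h3 (Or.inl r3) with g | g | g | g | g <;> try linarith [g.1, g.2.1]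
      have := hC4 (x 3) (x 1)
        (rng (Or.inr ⟨by linarith [h.1, h.2.1, g.1, g.2.1], by linarith [h.1, h.2.1, g.1, g.2.1]⟩))
        (rng (Or.inr ⟨by linarith [h.1, h.2.1, g.1, g.2.1], by linarith [h.1, h.2.1, g.1, g.2.1]⟩))
        (rng (Or.inr ⟨by linarith [h.1, h.2.1, g.1, g.2.1], by linarith [h.1, h.2.1, g.1, g.2.1]⟩))
        (rng (Or.inr ⟨by linarith [h.1, h.2.1, g.1, g.2.1], by linarith [h.1, h.2.1, g.1, g.2.1]⟩))
        (by linarith [h.2.2, g.2.2])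
      linarith [h.2.2, g.2.2]
    rw [rr_t r2, rr_t r3, rr_f r4, bb_f (RR2 r2 r3)]
    linarith [bb_sum2 c1 c3 (fun h => c2 h.symm)]
  · -- RLRLR
    have x21 := R2 r2
    have x23 := L3 r3
    have x43 := R4 r4
    have c1 : ¬ (M 1 ∧ M 3) := by
      rintro ⟨h1, h4⟩
      rcases A1 h1 (Or.inr r2) with h | h | h | h | h <;>
      rcases A3 h4 (Or.inr r4) with g | g | g | g | g <;>
      linarith [h.1, h.2.1, g.1, g.2.1]
    have c2 : ¬ (M 1 ∧ M 2) := by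
      rintro ⟨h1, h2⟩
      have hsl := sl1 h1 (by simp [r1, r2])
      rcases A2 h2 (Or.inl r2) with h | h | h | h | h <;> try linarith [h.1, h.2.1]
      linarith [h.2.2, mul_pos (sub_pos.mpr hsl) (sub_pos.mpr x21)]
    have c3 : ¬ (M 2 ∧ M 3) := by
      rintro ⟨h2, h3⟩
      have hsl := sl2 h2 (by simp [r2, r3])
      rcases B3 h3 (Or.inr r4) with h | h | h | h | h <;> try linarith [h.1, h.2.1]
      linarith [h.2.2, mul_pos (sub_pos.mpr hsl) (sub_pos.mpr x23)]
    rw [rr_t r2, rr_f r3, rr_t r4, bb_f (RR4 r4 r0)]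
    linarith [bb_sum2 c1 c2 (fun h => c3 h.symm)]
  · -- RLRLL
    have x21 := R2 r2
    have x23 := L3 r3
    have x34 := L4 r4
    have c1 : ¬ (M 1 ∧ M 4) := by
      rintro ⟨h1, h4⟩
      rcases A1 h1 (Or.inr r2) with h | h | h | h | h <;>
      rcases A4 h4 (Or.inr r0) with g | g | g | g | g <;>
      linarith [h.1, h.2.1, g.1, g.2.1]
    have c2 : ¬ (M 1 ∧ M 2) := by
      rintro ⟨h1, h2⟩
      have hsl := sl1 h1 (by simp [r1, r2])
      rcases A2 h2 (Or.inl r2) with h | h | h | h | h <;> try linarith [h.1, h.2.1]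
      linarith [h.2.2, mul_pos (sub_pos.mpr hsl) (sub_pos.mpr x21)]
    have c3 : ¬ (M 2 ∧ M 4) := by
      rintro ⟨h2, h4⟩
      rcases B2 h2 (Or.inl r2) with h | h | h | h | h <;> try linarith [h.1, h.2.1]
      rcases B4 h4 (Or.inr r0) with g | g | g | g | g <;> try linarith [g.1, g.2.1]
      have := hC0 (x 2) (x 4)
        (rng (Or.inl ⟨by linarith [h.1, h.2.1, g.1, g.2.1], by linarith [h.1, h.2.1, g.1, g.2.1]⟩))
        (rng (Or.inl ⟨by linarith [h.1, h.2.1, g.1, g.2.1], by linarith [h.1, h.2.1, g.1, g.2.1]⟩))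
        (rng (Or.inl ⟨by linarith [h.1, h.2.1, g.1, g.2.1], by linarith [h.1, h.2.1, g.1, g.2.1]⟩))
        (rng (Or.inl ⟨by linarith [h.1, h.2.1, g.1, g.2.1], by linarith [h.1, h.2.1, g.1, g.2.1]⟩))
        (by linarith [h.2.2, g.2.2])
      linarith [h.2.2, g.2.2]
    rw [rr_t r2, rr_f r3, rr_f r4]
    linarith [bb_sum2 c1 c2 (fun h => c3 h.symm), bb_le (M 3)]
  · -- RLLRR
    have := L2 r2
    have := R3 r3
    have := R4 r4
    have m2 : ¬ M 2 := fun h => by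
      rcases A2 h (Or.inr r3) with h | h | h | h | h <;> linarith [h.1, h.2.1]
    rw [rr_f r2, rr_t r3, rr_t r4, bb_f m2, bb_f (RR3 r3 r4), bb_f (RR4 r4 r0)]
    linarith [bb_le (M 1)]
  · -- RLLRL
    have x12 := L2 r2
    have x32 := R3 r3
    have x34 := L4 r4
    have c1 : ¬ (M 2 ∧ M 4) := by
      rintro ⟨h1, h4⟩
      rcases A2 h1 (Or.inr r3) with h | h | h | h | h <;>
      rcases A4 h4 (Or.inr r0) with g | g | g | g | g <;>
      linarith [h.1, h.2.1, g.1, g.2.1]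
    have c2 : ¬ (M 3 ∧ M 4) := by
      rintro ⟨h3, h4⟩
      have hsl := sl4 h4 (by simp [r4, r0])
      rcases B3 h3 (Or.inl r3) with h | h | h | h | h <;> try linarith [h.1, h.2.1]
      linarith [h.2.2, mul_pos (sub_pos.mpr hsl) (sub_pos.mpr x34)]
    have c3 : ¬ (M 2 ∧ M 3) := by
      rintro ⟨h2, h3⟩
      have hsl := sl3 h3 (by simp [r3, r4])
      rcases A2 h2 (Or.inr r3) with h | h | h | h | h <;> try linarith [h.1, h.2.1]
      linarith [h.2.2, mul_pos (sub_pos.mpr hsl) (sub_pos.mpr x32)]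
    rw [rr_f r2, rr_t r3, rr_f r4]
    linarith [bb_sum2 c1 c3 (fun h => c2 h.symm), bb_le (M 1)]
  · -- RLLLR
    have := L2 r2
    have := L3 r3
    have := R4 r4
    have m2 : ¬ M 3 := fun h => by
      rcases A3 h (Or.inr r4) with h | h | h | h | h <;> linarith [h.1, h.2.1]
    rw [rr_f r2, rr_f r3, rr_t r4, bb_f m2, bb_f (RR4 r4 r0)]
    linarith [bb_le (M 1), bb_le (M 2)]
  · -- RLLLL
    have := L2 r2
    have := L3 r3
    have := L4 r4
    have m2 : ¬ M 4 := fun h => by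
      rcases A4 h (Or.inr r0) with h | h | h | h | h <;> linarith [h.1, h.2.1]
    rw [rr_f r2, rr_f r3, rr_f r4, bb_f m2]
    linarith [bb_le (M 1), bb_le (M 2), bb_le (M 3)]

lemma four (P : Poly 4) (hP : ¬ P.R 2 ∧ P.R 3) :
    ∑ i, (rr (P.R i) + 2 * bb (P.M i)) ≤ 2 := by
  obtain ⟨r0, r1, m0⟩ := P.first
  obtain ⟨r2, r3⟩ := hP
  have x1 : P.x 0 < P.x 1 := P.hL 1 r1
  have x2 : P.x 1 < P.x 2 := P.hL 2 r2
  have x3 : P.x 3 < P.x 2 := P.hR 3 r3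
  have x0 : P.x 0 < P.x 3 := P.hR 0 r0
  have m3 : ¬ P.M 3 := P.hRR 3 r3 r0
  have m2 : ¬ P.M 2 := fun h => by
    obtain ⟨j, -, h1, -⟩ := P.hA 2 h (Or.inr r3)
    fin_cases j <;> simp at h1 <;> linarith
  rw [Fin.sum_univ_four, rr_t r0, rr_f r1, rr_f r2, rr_t r3, bb_f m0, bb_f m2, bb_f m3]
  linarith [bb_le (P.M 1)]

lemma three (P : Poly 3) : ∑ i, (rr (P.R i) + 2 * bb (P.M i)) ≤ 1 := by
  obtain ⟨r0, r1, m0⟩ := P.first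
  have x1 : P.x 0 < P.x 1 := P.hL 1 r1
  have x0 : P.x 0 < P.x 2 := P.hR 0 r0
  by_cases r2 : P.R 2
  · have x2 : P.x 2 < P.x 1 := P.hR 2 r2
    have m2 : ¬ P.M 2 := P.hRR 2 r2 r0
    have m1 : ¬ P.M 1 := fun h => by
      obtain ⟨j, -, h1, -⟩ := P.hA 1 h (Or.inr r2)
      fin_cases j <;> simp at h1 <;> linarith
    rw [Fin.sum_univ_three, rr_t r0, rr_f r1, rr_t r2, bb_f m0, bb_f m1, bb_f m2]
    norm_num
  · have x2 : P.x 1 < P.x 2 := P.hL 2 r2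
    have m2 : ¬ P.M 2 := fun h => by
      obtain ⟨j, -, h1, -⟩ := P.hA 2 h (Or.inr r0)
      fin_cases j <;> simp at h1 <;> linarith
    rw [Fin.sum_univ_three, rr_t r0, rr_f r1, rr_f r2, bb_f m0, bb_f m2]
    linarith [bb_le (P.M 1)]

end Poly
end MSProof

namespace MSProof
open Classical
namespace Cfg
variable {V : Type} [Fintype V] (K : Cfg V)

/-- cyclic listing of an inner face, starting at the leftmost vertex -/
structure Lst (f : K.Face) (k : ℕ) [NeZero k] (d : Fin k → K.G.Dart) : Prop where
  fc : ∀ i, K.fc (d i) = f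
  ph : ∀ i, d (i + 1) = K.ph (d i)
  surj : ∀ e, K.fc e = f → ∃ i, e = d i
  sum : ∀ F : K.G.Dart → ℝ, ∑ e ∈ K.fib f, F e = ∑ i, F (d i)
  left : ∀ i, K.X (d 0).fst ≤ K.X (d i).fst

variable {K}
variable {f : K.Face} {k : ℕ} [NeZero k] {d : Fin k → K.G.Dart}

lemma Lst.snd (h : K.Lst f k d) (i : Fin k) : (d i).snd = (d (i - 1)).fst := by
  have := h.ph (i - 1)
  rw [sub_add_cancel] at this
  rw [this, ph_snd]

lemma Lst.n1 (h : K.Lst f k d) (i : Fin k) : (d (i + 1)).fst ≠ (d i).fst := by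
  rw [h.ph]; exact K.nb1 _

lemma Lst.n2 (h : K.Lst f k d) (i : Fin k) : (d (i + 1 + 1)).fst ≠ (d i).fst := by
  rw [h.ph]
  have := K.nb2 (d (i + 1))
  rwa [h.snd, add_sub_cancel_right] at this

noncomputable def Lst.poly (h : K.Lst f k d) (hf : K.Inner f) : Poly k where
  x i := K.X (d i).fst
  y i := K.Y (d i).fst
  s i := K.s (d i)
  R i := K.R (d i)
  M i := K.mx (d i)
  hR i hi := by rw [← h.snd]; exact hi
  hL i hi := by
    rw [← h.snd]
    exact lt_of_le_of_ne (not_lt.mp hi) (Ne.symm (K.Xne _))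
  hs i := by rw [← h.snd]; exact K.s_mul _
  hLL i h1 h2 := by rw [h.ph] at h2; exact K.mx_LL h1 h2
  hRR i h1 h2 := by rw [h.ph] at h2; exact K.mx_RR h1 h2
  hsl i h1 h2 := by rw [h.ph] at h2 ⊢; exact K.mx_slope h1 h2
  hA i h1 h2 := by
    rw [h.ph] at h2
    obtain ⟨⟨e, he, hef⟩, -⟩ := K.wrap_edges hf (h.fc i) h1 h2
    obtain ⟨j, hj⟩ := h.surj _ hef
    refine ⟨j, ?_⟩
    rw [← h.snd, ← hj]
    refine ⟨he.1, he.2.1, ?_⟩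
    have := he.2.2
    rw [← ht_symm] at this
    exact this
  hB i h1 h2 := by
    rw [h.ph] at h2
    obtain ⟨-, ⟨e, he, hef⟩⟩ := K.wrap_edges hf (h.fc i) h1 h2
    obtain ⟨j, hj⟩ := h.surj _ hef
    refine ⟨j, ?_⟩
    rw [← h.snd, ← hj]
    exact ⟨he.1, he.2.1, he.2.2⟩
  hl := h.left

lemma Lst.angle (h : K.Lst f k d) (hf : K.Inner f) : ∑ i, K.th (d i) =
    Real.pi * ∑ i, (rr ((h.poly hf).R i) + 2 * bb ((h.poly hf).M i)) := by
  have h1 : ∀ F : K.G.Dart → ℝ, ∑ i, F (K.ph (d i)) = ∑ i, F (d i) := by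
    intro F
    rw [← Equiv.sum_comp (Equiv.addRight (1 : Fin k)) (fun i => F (d i))]
    refine Finset.sum_congr rfl fun i _ => ?_
    rw [← h.ph]; rfl
  have h2 : ∀ i, K.th (d i) = K.a (K.ph (d i)) - K.a (d i) + Real.pi * rr (K.R (K.ph (d i)))
      + Real.pi * (2 * bb (K.mx (d i))) := by
    intro i
    rw [th_eq, rr, bb]
    split_ifs <;> ring
  simp only [h2, Finset.sum_add_distrib, Finset.sum_sub_distrib]
  rw [h1 K.a, h1 (fun e => Real.pi * rr (K.R e)), sub_self, zero_add, mul_add, Finset.mul_sum,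
    Finset.mul_sum]
  rfl

lemma orient (d : K.G.Dart) : ∃ d' : K.G.Dart, K.R d' ∧ (∀ t, K.ht d' t = K.ht d t) ∧
    ((d'.fst = d.fst ∧ d'.snd = d.snd) ∨ (d'.fst = d.snd ∧ d'.snd = d.fst)) := by
  by_cases h : K.R d
  · exact ⟨d, h, fun _ => rfl, Or.inl ⟨rfl, rfl⟩⟩
  · exact ⟨d.symm, (K.R_symm d).mpr h, K.ht_symm d, Or.inr ⟨rfl, rfl⟩⟩

lemma rng_inv {a b t : ℝ} (h : a < b) (ht : (t - a) * (t - b) ≤ 0) : a ≤ t ∧ t ≤ b := by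
  constructor <;> by_contra hc <;> push Not at hc <;> nlinarith

lemma const_sign' (d e : K.G.Dart) 
    (h1 : d.fst ≠ e.fst) (h2 : d.fst ≠ e.snd) (h3 : d.snd ≠ e.fst) (h4 : d.snd ≠ e.snd)
    (t t' : ℝ) (a1 : (t - K.X d.fst) * (t - K.X d.snd) ≤ 0)
    (a2 : (t - K.X e.fst) * (t - K.X e.snd) ≤ 0)
    (a3 : (t' - K.X d.fst) * (t' - K.X d.snd) ≤ 0)
    (a4 : (t' - K.X e.fst) * (t' - K.X e.snd) ≤ 0)
    (h : K.ht d t < K.ht e t) : K.ht d t' < K.ht e t' := by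
  obtain ⟨d', hd, hd2, hd3⟩ := orient d
  obtain ⟨e', he, he2, he3⟩ := orient e
  rw [← hd2, ← he2] at h ⊢
  have b1 : (t - K.X d'.fst) * (t - K.X d'.snd) ≤ 0 := by
    rcases hd3 with ⟨q1, q2⟩ | ⟨q1, q2⟩ <;> rw [q1, q2] <;> linarith
  have b2 : (t - K.X e'.fst) * (t - K.X e'.snd) ≤ 0 := by
    rcases he3 with ⟨q1, q2⟩ | ⟨q1, q2⟩ <;> rw [q1, q2] <;> linarith
  have b3 : (t' - K.X d'.fst) * (t' - K.X d'.snd) ≤ 0 := by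
    rcases hd3 with ⟨q1, q2⟩ | ⟨q1, q2⟩ <;> rw [q1, q2] <;> linarith
  have b4 : (t' - K.X e'.fst) * (t' - K.X e'.snd) ≤ 0 := by
    rcases he3 with ⟨q1, q2⟩ | ⟨q1, q2⟩ <;> rw [q1, q2] <;> linarith
  have c1 := rng_inv hd b1
  have c2 := rng_inv he b2
  have c3 := rng_inv hd b3
  have c4 := rng_inv he b4
  have hh : d'.fst ≠ e'.fst ∧ d'.fst ≠ e'.snd ∧ d'.snd ≠ e'.fst ∧ d'.snd ≠ e'.snd := by
    rcases hd3 with ⟨q1, q2⟩ | ⟨q1, q2⟩ <;> rcases he3 with ⟨q3, q4⟩ | ⟨q3, q4⟩ <;>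
    rw [q1, q2, q3, q4] <;> tauto
  exact K.const_sign hd he hh.1 hh.2.1 hh.2.2.1 hh.2.2.2 c1.1 c1.2 c2.1 c2.2 c3.1 c3.2 c4.1 c4.2 h

lemma angle5 {d : Fin 5 → K.G.Dart} (h : K.Lst f 5 d) (hf : K.Inner f) :
    ∑ i, K.th (d i) ≤ 3 * Real.pi := by
  rw [h.angle hf]
  have := (h.poly hf).five ?_
  · nlinarith [Real.pi_pos]
  · intro i t t' a1 a2 a3 a4 h1
    have e1 : i + 2 = i + 1 + 1 := by rw [add_assoc]; rfl
    have s1 : (d (i + 2)).snd = (d (i + 1)).fst := by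
      rw [h.snd, e1, add_sub_cancel_right]
    have s2 := h.snd i
    refine const_sign' (d i) (d (i + 2)) ?_ ?_ ?_ ?_ t t' ?_ ?_ ?_ ?_ h1
    · rw [e1]; exact (h.n2 i).symm
    · rw [s1]; exact (h.n1 i).symm
    · rw [s2]
      have := h.n2 (i + 2)
      have e2 : i + 2 + 1 + 1 = i - 1 := by
        rw [sub_eq_add_neg, add_assoc, add_assoc]; rfl
      rwa [e2] at this
    · rw [s1, s2]
      have := h.n2 (i - 1)
      rw [sub_add_cancel] at this
      exact this.symm
    · rw [s2]; exact a1
    · rw [s1]; exact a2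
    · rw [s2]; exact a3
    · rw [s1]; exact a4

lemma angle3 {d : Fin 3 → K.G.Dart} (h : K.Lst f 3 d) (hf : K.Inner f) :
    ∑ i, K.th (d i) ≤ Real.pi := by
  rw [h.angle hf]
  have := (h.poly hf).three
  nlinarith [Real.pi_pos]

lemma rhomb {x0 x1 x2 x3 y0 y1 y2 y3 : ℝ} (h1 : (x0 - x1) ^ 2 + (y0 - y1) ^ 2 = 1)
    (h2 : (x1 - x2) ^ 2 + (y1 - y2) ^ 2 = 1) (h3 : (x2 - x3) ^ 2 + (y2 - y3) ^ 2 = 1)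
    (h0 : (x3 - x0) ^ 2 + (y3 - y0) ^ 2 = 1) (n1 : x2 ≠ x0) (n2 : x3 ≠ x1) :
    x0 + x2 = x1 + x3 ∧ y0 + y2 = y1 + y3 := by
  obtain ⟨a, ha⟩ : ∃ a, a = x2 - x0 := ⟨_, rfl⟩
  obtain ⟨b, hb⟩ : ∃ b, b = y2 - y0 := ⟨_, rfl⟩
  obtain ⟨c, hc⟩ : ∃ c, c = x1 - x3 := ⟨_, rfl⟩
  obtain ⟨e, he⟩ : ∃ e, e = y1 - y3 := ⟨_, rfl⟩
  obtain ⟨g, hg⟩ : ∃ g, g = x1 - x0 + (x3 - x0) := ⟨_, rfl⟩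
  obtain ⟨k, hk⟩ : ∃ k, k = y1 - y0 + (y3 - y0) := ⟨_, rfl⟩
  have p1 : a * c + b * e = 0 := by
    subst ha hb hc he; linear_combination (h1 - h0 - h2 + h3) / 2
  have p2 : c * g + e * k = 0 := by
    subst hc he hg hk; linear_combination h1 - h0
  have p3 : a * g + b * k = a ^ 2 + b ^ 2 := by
    subst ha hb hg hk; linear_combination (h1 + h0 - h2 - h3) / 2
  have c0 : c ≠ 0 := by rw [hc]; exact sub_ne_zero.mpr (Ne.symm n2)
  have a0 : a ≠ 0 := by rw [ha]; exact sub_ne_zero.mpr n1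
  have q : a * k - b * g = 0 := by
    have : c * (a * k - b * g) = 0 := by linear_combination k * p1 - b * p2
    exact (mul_eq_zero.mp this).resolve_left c0
  have hpos : a ^ 2 + b ^ 2 ≠ 0 := by positivity
  have r1 : g = a := by
    have : (a ^ 2 + b ^ 2) * (g - a) = 0 := by linear_combination a * p3 - b * q
    linarith [(mul_eq_zero.mp this).resolve_left hpos]
  have r2 : k = b := by
    have : (a ^ 2 + b ^ 2) * (k - b) = 0 := by linear_combination b * p3 + a * q
    linarith [(mul_eq_zero.mp this).resolve_left hpos]
  constructor <;> linarith

lemma th_ext {d e : K.G.Dart} (h1 : Real.cos (K.th d) = Real.cos (K.th e))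
    (h2 : Real.sin (K.th d) = Real.sin (K.th e)) : K.th d = K.th e := by
  have h3 : Real.cos (K.th d - K.th e) = 1 := by
    rw [Real.cos_sub, h1, h2]; nlinarith [Real.sin_sq_add_cos_sq (K.th e)]
  rw [Real.cos_eq_one_iff_of_lt_of_lt (by linarith [K.th_pos d, K.th_lt e])
    (by linarith [K.th_pos e, K.th_lt d])] at h3
  linarith

lemma unit' (e : K.G.Dart) : (K.X e.snd - K.X e.fst) ^ 2 + (K.Y e.snd - K.Y e.fst) ^ 2 = 1 :=
  K.unit _ _ e.adj

lemma angle4 {d : Fin 4 → K.G.Dart} (h : K.Lst f 4 d) (hf : K.Inner f) :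
    K.th (d 2) = K.th (d 0) ∧ K.th (d 3) = K.th (d 1) ∧ K.th (d 0) + K.th (d 1) ≤ Real.pi := by
  have s0 : (d 0).snd = (d 3).fst := h.snd 0
  have s1 : (d 1).snd = (d 0).fst := h.snd 1
  have s2 : (d 2).snd = (d 1).fst := h.snd 2
  have s3 : (d 3).snd = (d 2).fst := h.snd 3
  have p0 : K.ph (d 0) = d 1 := (h.ph 0).symm
  have p1 : K.ph (d 1) = d 2 := (h.ph 1).symm
  have p2 : K.ph (d 2) = d 3 := (h.ph 2).symm
  have p3 : K.ph (d 3) = d 0 := (h.ph 3).symm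
  have u0 := unit' (d 0)
  have u1 := unit' (d 1)
  have u2 := unit' (d 2)
  have u3 := unit' (d 3)
  rw [s0] at u0
  rw [s1] at u1
  rw [s2] at u2
  rw [s3] at u3
  have n1 : (d 2).fst ≠ (d 0).fst := h.n2 0
  have n2 : (d 3).fst ≠ (d 1).fst := h.n2 1
  obtain ⟨rx, ry⟩ := rhomb u1 u2 u3 u0 (fun h => n1 (K.injX h)) (fun h => n2 (K.injX h))
  have t1 : K.th (d 2) = K.th (d 0) := by
    apply th_ext
    · rw [cos_th, cos_th, p0, p2, s0, s1, s2, s3,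
        show K.X (d 2).fst = K.X (d 1).fst + K.X (d 3).fst - K.X (d 0).fst by linarith,
        show K.Y (d 2).fst = K.Y (d 1).fst + K.Y (d 3).fst - K.Y (d 0).fst by linarith]
      ring
    · rw [sin_th, sin_th, p0, p2, s0, s1, s2, s3,
        show K.X (d 2).fst = K.X (d 1).fst + K.X (d 3).fst - K.X (d 0).fst by linarith,
        show K.Y (d 2).fst = K.Y (d 1).fst + K.Y (d 3).fst - K.Y (d 0).fst by linarith]
      ring
  have t2 : K.th (d 3) = K.th (d 1) := by
    apply th_ext
    · rw [cos_th, cos_th, p1, p3, s0, s1, s2, s3,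
        show K.X (d 2).fst = K.X (d 1).fst + K.X (d 3).fst - K.X (d 0).fst by linarith,
        show K.Y (d 2).fst = K.Y (d 1).fst + K.Y (d 3).fst - K.Y (d 0).fst by linarith]
      ring
    · rw [sin_th, sin_th, p1, p3, s0, s1, s2, s3,
        show K.X (d 2).fst = K.X (d 1).fst + K.X (d 3).fst - K.X (d 0).fst by linarith,
        show K.Y (d 2).fst = K.Y (d 1).fst + K.Y (d 3).fst - K.Y (d 0).fst by linarith]
      ring
  refine ⟨t1, t2, ?_⟩
  have hsum := h.angle hf
  obtain ⟨r0, r1, -⟩ := (h.poly hf).first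
  have x0 : K.X (d 0).fst < K.X (d 3).fst := (h.poly hf).hR 0 r0
  have x1 : K.X (d 0).fst < K.X (d 1).fst := (h.poly hf).hL 1 r1
  have r2 : ¬ K.R (d 2) := by
    intro hr
    have : K.X (d 2).fst < K.X (d 2).snd := hr
    rw [s2] at this; linarith
  have r3 : K.R (d 3) := by
    show K.X (d 3).fst < K.X (d 3).snd
    rw [s3]; linarith
  have := (h.poly hf).four ⟨r2, r3⟩
  rw [Fin.sum_univ_four] at hsum
  have : K.th (d 0) + K.th (d 1) + K.th (d 2) + K.th (d 3) ≤ Real.pi * 2 := by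
    rw [hsum]; exact mul_le_mul_of_nonneg_left this Real.pi_pos.le
  linarith

lemma th3 {d : Fin 3 → K.G.Dart} (h : K.Lst f 3 d) (i : Fin 3) : Real.pi / 3 ≤ K.th (d i) := by
  have hc : Real.cos (K.th (d i)) = 1 / 2 := by
    have e1 := h.snd i
    have e2 := h.snd (i + 1)
    have e3 := h.snd (i + 1 + 1)
    rw [add_sub_cancel_right] at e2 e3
    have e4 : i - 1 = i + 1 + 1 := by
      rw [sub_eq_add_neg, add_assoc]; rfl
    rw [e4] at e1
    rw [cos_th, ← h.ph, e1, e2]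
    have u1 := unit' (d i)
    have u2 := unit' (d (i + 1))
    have u3 := unit' (d (i + 1 + 1))
    rw [e1] at u1
    rw [e2] at u2
    rw [e3] at u3
    linear_combination (u1 + u2 - u3) / 2
  by_contra hlt
  push Not at hlt
  have := Real.cos_lt_cos_of_nonneg_of_le_pi (K.th_pos (d i)).le
    (by linarith [Real.pi_pos] : Real.pi / 3 ≤ Real.pi) hlt
  rw [Real.cos_pi_div_three] at this
  linarith

end Cfg
end MSProof

namespace MSProof
open Classical
namespace Cfg
variable {V : Type} [Fintype V] (K : Cfg V)

noncomputable def WW (q : ℝ) : ℝ := max (-1/9) (min (4/9) (-2/3 + 5/3 * q))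

lemma WW_le (q : ℝ) : WW q ≤ 4/9 := by
  unfold WW; exact max_le (by norm_num) (min_le_left _ _)
lemma le_WW (q : ℝ) : -1/9 ≤ WW q := le_max_left _ _
lemma WW_top {q : ℝ} (h : 4/9 ≤ -2/3 + 5/3 * q) : WW q = 4/9 := by
  unfold WW; rw [min_eq_left h]; norm_num
lemma lin_le_WW {q : ℝ} (h : -2/3 + 5/3 * q ≤ 4/9) : -2/3 + 5/3 * q ≤ WW q := by
  unfold WW; rw [min_eq_right h]; exact le_max_right _ _
lemma WW_le_lin {q : ℝ} (h : -1/9 ≤ -2/3 + 5/3 * q) : WW q ≤ -2/3 + 5/3 * q := by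
  unfold WW; exact max_le h (min_le_right _ _)
lemma WW_bot {q : ℝ} (h : q ≤ 1/3) : WW q = -1/9 := by
  unfold WW; rw [min_eq_right (by linarith)]; exact max_eq_left (by linarith)
lemma WW_pair {p q : ℝ} (h : p + q ≤ 1) : WW p + WW q ≤ 1/3 := by
  rcases le_total p (1/3) with h1 | h1
  · rw [WW_bot h1]; linarith [WW_le q]
  rcases le_total q (1/3) with h2 | h2
  · rw [WW_bot h2]; linarith [WW_le p]
  linarith [WW_le_lin (q := p) (by linarith), WW_le_lin (q := q) (by linarith)]

noncomputable def wt (d : K.G.Dart) : ℝ := WW (K.th d / Real.pi)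

lemma vertex_wt (v : V) :
    0 ≤ ∑ d ∈ Finset.univ.filter (fun d : K.G.Dart => d.fst = v), K.wt d := by
  have hs := K.vertex_sum v
  have hc := K.deg v
  set S := Finset.univ.filter (fun d : K.G.Dart => d.fst = v)
  by_cases h : ∃ d ∈ S, 4/9 ≤ -2/3 + 5/3 * (K.th d / Real.pi)
  · obtain ⟨d, hd, h1⟩ := h
    rw [← Finset.add_sum_erase _ _ hd]
    have h2 : K.wt d = 4/9 := WW_top h1
    have h3 := Finset.card_nsmul_le_sum (S.erase d) K.wt (-1/9) (fun e _ => le_WW _)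
    rw [Finset.card_erase_of_mem hd, hc] at h3
    norm_num at h3
    linarith
  · push Not at h
    have h1 : ∑ d ∈ S, (-2/3 + 5/3 * (K.th d / Real.pi)) ≤ ∑ d ∈ S, K.wt d :=
      Finset.sum_le_sum fun d hd => lin_le_WW (h d hd).le
    rw [Finset.sum_add_distrib, Finset.sum_const, hc, ← Finset.mul_sum, ← Finset.sum_div, hs] at h1
    rw [mul_div_assoc, div_self Real.pi_pos.ne'] at h1
    norm_num at h1
    linarith

lemma exists_Lst (f : K.Face) {k : ℕ} [NeZero k] (hk : (K.fib f).card = k) :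
    ∃ d, K.Lst f k d := by
  obtain ⟨d, h1, h2, h3, h4, h5⟩ := K.face_param k hk
  exact ⟨d, h1, h2, h3, h4, h5⟩

lemma three_le (f : K.Face) : 3 ≤ (K.fib f).card := by
  by_contra hlt
  have h0 : (K.fib f).card ≠ 0 := by
    obtain ⟨d, hd⟩ := K.fc_surj f
    exact (Finset.card_pos.mpr ⟨d, K.mem_fib.mpr hd⟩).ne'
  have : (K.fib f).card = 1 ∨ (K.fib f).card = 2 := by omega
  rcases this with h | h
  · obtain ⟨d, hd⟩ := K.exists_Lst f h
    exact hd.n1 0 rfl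
  · obtain ⟨d, hd⟩ := K.exists_Lst f h
    exact hd.n2 0 rfl

lemma face_top (f : K.Face) : ∑ d ∈ K.fib f, K.wt d ≤ 4/9 * (K.fib f).card := by
  have := Finset.sum_le_card_nsmul (K.fib f) K.wt (4/9) (fun e _ => WW_le _)
  rw [nsmul_eq_mul] at this
  linarith

lemma face_wt {f : K.Face} (hf : K.Inner f) :
    ∑ d ∈ K.fib f, K.wt d ≤ (K.fib f).card - 10/3 := by
  have h3 := K.three_le f
  have htop := K.face_top f
  have hpi := Real.pi_pos
  by_cases h6 : 6 ≤ (K.fib f).card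
  · have : (6:ℝ) ≤ (K.fib f).card := by exact_mod_cast h6
    linarith
  have : (K.fib f).card = 3 ∨ (K.fib f).card = 4 ∨ (K.fib f).card = 5 := by omega
  rcases this with h | h | h
  · obtain ⟨d, hd⟩ := K.exists_Lst f h
    rw [hd.sum, h, Fin.sum_univ_three]
    have hs := angle3 hd hf
    rw [Fin.sum_univ_three] at hs
    have a0 := th3 hd 0
    have a1 := th3 hd 1
    have a2 := th3 hd 2
    have w0 : K.wt (d 0) = -1/9 := WW_bot (by rw [div_le_iff₀ hpi]; linarith)
    have w1 : K.wt (d 1) = -1/9 := WW_bot (by rw [div_le_iff₀ hpi]; linarith)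
    have w2 : K.wt (d 2) = -1/9 := WW_bot (by rw [div_le_iff₀ hpi]; linarith)
    rw [w0, w1, w2]; norm_num
  · obtain ⟨d, hd⟩ := K.exists_Lst f h
    rw [hd.sum, h, Fin.sum_univ_four]
    obtain ⟨a1, a2, a3⟩ := angle4 hd hf
    have := WW_pair (p := K.th (d 0) / Real.pi) (q := K.th (d 1) / Real.pi)
      (by rw [← add_div, div_le_one hpi]; exact a3)
    simp only [wt, a1, a2]
    push_cast
    linarith
  · obtain ⟨d, hd⟩ := K.exists_Lst f h
    rw [hd.sum, h]
    have hs := angle5 hd hf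
    by_cases hex : ∃ i, K.th (d i) / Real.pi ≤ 1/3
    · obtain ⟨i, hi⟩ := hex
      rw [← Finset.add_sum_erase _ _ (Finset.mem_univ i)]
      have h2 : K.wt (d i) = -1/9 := WW_bot hi
      have h3 := Finset.sum_le_card_nsmul (Finset.univ.erase i) (fun i => K.wt (d i)) (4/9)
        (fun e _ => WW_le _)
      rw [Finset.card_erase_of_mem (Finset.mem_univ i)] at h3
      norm_num at h3 ⊢
      linarith
    · push Not at hex
      have h1 : ∑ i, K.wt (d i) ≤ ∑ i, (-2/3 + 5/3 * (K.th (d i) / Real.pi)) :=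
        Finset.sum_le_sum fun i _ => WW_le_lin (by linarith [hex i])
      rw [Finset.sum_add_distrib, Finset.sum_const, ← Finset.mul_sum, ← Finset.sum_div] at h1
      have h2 : (∑ i, K.th (d i)) / Real.pi ≤ 3 := by rw [div_le_iff₀ hpi]; exact hs
      norm_num at h1 ⊢
      linarith

theorem contra {V : Type} [Fintype V] (K : Cfg V) : False := by
  obtain ⟨f0, hf0⟩ := K.exists_f0
  have hV : 0 ≤ ∑ d : K.G.Dart, K.wt d := by
    rw [← Finset.sum_fiberwise_of_maps_to (g := fun d : K.G.Dart => d.fst) (t := Finset.univ)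
      (fun _ _ => Finset.mem_univ _)]
    exact Finset.sum_nonneg fun v _ => K.vertex_wt v
  have hF : ∑ d : K.G.Dart, K.wt d = ∑ f : K.Face, ∑ d ∈ K.fib f, K.wt d :=
    (Finset.sum_fiberwise_of_maps_to (g := K.fc) (t := Finset.univ)
      (fun _ _ => Finset.mem_univ _) _).symm
  have hcard : (Fintype.card K.G.Dart : ℝ) = ∑ f : K.Face, ((K.fib f).card : ℝ) := by
    rw [← Finset.card_univ, Finset.card_eq_sum_card_fiberwise (f := K.fc)
      (t := Finset.univ) (fun _ _ => Finset.mem_coe.mpr (Finset.mem_univ _))]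
    push_cast; rfl
  have hle : ∑ f : K.Face, ∑ d ∈ K.fib f, K.wt d ≤
      ∑ f : K.Face, (((K.fib f).card : ℝ) - 10/3 + (if f = f0 then 5/3 else 0)) := by
    refine Finset.sum_le_sum fun f _ => ?_
    by_cases h : f = f0
    · rw [if_pos h]
      have h1 := K.face_top f
      have h2 : (3:ℝ) ≤ (K.fib f).card := by exact_mod_cast K.three_le f
      linarith
    · rw [if_neg h, add_zero]
      exact K.face_wt (hf0 f h)
  rw [Finset.sum_add_distrib, Finset.sum_sub_distrib, ← hcard, Finset.sum_const,
    Finset.sum_ite_eq' , if_pos (Finset.mem_univ _), Finset.card_univ, nsmul_eq_mul] at hle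
  have e1 : (Fintype.card K.RD : ℝ) + 1 ≤ Fintype.card V + Fintype.card K.Face := by
    exact_mod_cast K.euler
  have e2 : 2 * (Fintype.card K.RD : ℝ) = 5 * Fintype.card V := by exact_mod_cast K.RD_card
  have e3 : (Fintype.card K.G.Dart : ℝ) = 5 * Fintype.card V := by exact_mod_cast K.dart_card
  linarith

end Cfg
end MSProof

namespace MSProof
open Classical

lemma exists_dir {V : Type} [Fintype V] (g : V → EuclideanSpace ℝ (Fin 2))
    (hg : Function.Injective g) :
    ∃ c s : ℝ, c ^ 2 + s ^ 2 = 1 ∧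
      Function.Injective (fun v => c * g v 0 + s * g v 1) := by
  obtain ⟨m, hm⟩ := Infinite.exists_notMem_finset
    (Finset.univ.image (fun p : V × V => -(g p.1 0 - g p.2 0) / (g p.1 1 - g p.2 1)))
  have hpos : 0 < 1 + m ^ 2 := by positivity
  have hr : 0 < Real.sqrt (1 + m ^ 2) := Real.sqrt_pos.mpr hpos
  have hr2 : Real.sqrt (1 + m ^ 2) ^ 2 = 1 + m ^ 2 := Real.sq_sqrt hpos.le
  refine ⟨1 / Real.sqrt (1 + m ^ 2), m / Real.sqrt (1 + m ^ 2), ?_, ?_⟩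
  · rw [div_pow, div_pow, hr2]; field_simp
  · intro u v h
    have h1 : g u 0 + m * g u 1 = g v 0 + m * g v 1 := by
      simp only at h
      field_simp at h
      linarith
    by_cases hy : g u 1 = g v 1
    · apply hg
      ext i
      fin_cases i
      · simp only [Fin.zero_eta]
        rw [hy] at h1; linarith
      · exact hy
    · exfalso
      apply hm
      refine Finset.mem_image.mpr ⟨(u, v), Finset.mem_univ _, ?_⟩
      have : g u 1 - g v 1 ≠ 0 := sub_ne_zero.mpr hy
      simp only
      rw [div_eq_iff this]
      linarith

lemma dist_sq (p q : EuclideanSpace ℝ (Fin 2)) (h : dist p q = 1) :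
    (q 0 - p 0) ^ 2 + (q 1 - p 1) ^ 2 = 1 := by
  rw [EuclideanSpace.dist_eq, Real.sqrt_eq_one, Fin.sum_univ_two, Real.dist_eq, Real.dist_eq,
    sq_abs, sq_abs] at h
  linarith

lemma mem_seg (p q : EuclideanSpace ℝ (Fin 2)) (s : ℝ) (h0 : 0 ≤ s) (h1 : s ≤ 1) :
    p + s • (q - p) ∈ segment ℝ p q := by
  rw [segment_eq_image']
  exact ⟨s, ⟨h0, h1⟩, rfl⟩

lemma reduction_connected {V : Type} [Fintype V] (G : SimpleGraph V)
    (g : V → EuclideanSpace ℝ (Fin 2)) (hc : G.Connected)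
    (hdeg : ∀ v : V, (G.neighborSet v).ncard = 5)
    (hinj : Function.Injective g)
    (hunit : ∀ i j : V, G.Adj i j → dist (g i) (g j) = 1)
    (hseg : ∀ i₁ j₁ i₂ j₂ : V, G.Adj i₁ j₁ → G.Adj i₂ j₂ →
      i₁ ≠ i₂ → i₁ ≠ j₂ → j₁ ≠ i₂ → j₁ ≠ j₂ →
      segment ℝ (g i₁) (g j₁) ∩ segment ℝ (g i₂) (g j₂) = ∅) : False := by
  obtain ⟨c, s, hcs, hX⟩ := exists_dir g hinj
  refine Cfg.contra (V := V)
    { G := G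
      X := fun v => c * g v 0 + s * g v 1
      Y := fun v => -s * g v 0 + c * g v 1
      injX := hX
      unit := ?_
      nocross := ?_
      conn := hc
      deg := ?_ }
  · intro i j h
    have := dist_sq _ _ (hunit i j h)
    linear_combination (c ^ 2 + s ^ 2) * this + hcs
  · intro a b d e hab hde n1 n2 n3 n4 x t hx0 hx1 ht0 ht1 e1 e2
    have h := hseg a b d e hab hde n1 n2 n3 n4
    have hmem : g a + x • (g b - g a) ∈ segment ℝ (g a) (g b) ∩ segment ℝ (g d) (g e) := by
      refine ⟨mem_seg _ _ x hx0 hx1, ?_⟩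
      have : g a + x • (g b - g a) = g d + t • (g e - g d) := by
        ext i
        fin_cases i
        · simp
          linear_combination c * e1 - s * e2 - (g a 0 + x * (g b 0 - g a 0) - g d 0 - t * (g e 0 - g d 0)) * hcs
        · simp
          linear_combination s * e1 + c * e2 - (g a 1 + x * (g b 1 - g a 1) - g d 1 - t * (g e 1 - g d 1)) * hcs
      rw [this]
      exact mem_seg _ _ t ht0 ht1
    rw [h] at hmem
    exact hmem
  · intro v
    have h1 := G.dart_fst_fiber_card_eq_degree v
    have h2 := hdeg v
    rw [Set.ncard_eq_toFinset_card'] at h2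
    rw [← h2]
    convert h1 using 1
    rw [← SimpleGraph.card_neighborFinset_eq_degree, SimpleGraph.neighborFinset]

lemma reduction {V : Type} [Fintype V] [Nonempty V] (G : SimpleGraph V)
    (g : V → EuclideanSpace ℝ (Fin 2))
    (hdeg : ∀ v : V, (G.neighborSet v).ncard = 5)
    (hinj : Function.Injective g)
    (hunit : ∀ i j : V, G.Adj i j → dist (g i) (g j) = 1)
    (hseg : ∀ i₁ j₁ i₂ j₂ : V, G.Adj i₁ j₁ → G.Adj i₂ j₂ →
      i₁ ≠ i₂ → i₁ ≠ j₂ → j₁ ≠ i₂ → j₁ ≠ j₂ →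
      segment ℝ (g i₁) (g j₁) ∩ segment ℝ (g i₂) (g j₂) = ∅) : False := by
  obtain ⟨v0⟩ := ‹Nonempty V›
  let C := G.connectedComponentMk v0
  refine reduction_connected (V := C) C.toSimpleGraph (fun v => g v.1)
    C.connected_toSimpleGraph ?_ ?_ ?_ ?_
  · intro v
    rw [← hdeg v.1, ← Set.ncard_image_of_injective _ Subtype.val_injective]
    congr 1
    ext w
    constructor
    · rintro ⟨u, hu, rfl⟩
      exact hu
    · intro hw
      exact ⟨⟨w, (SimpleGraph.ConnectedComponent.mem_supp_congr_adj C hw).mp v.2⟩, hw, rfl⟩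
  · exact hinj.comp Subtype.val_injective
  · intro i j h
    exact hunit _ _ h
  · intro i j k l h1 h2 n1 n2 n3 n4
    exact hseg _ _ _ _ h1 h2 (fun h => n1 (Subtype.ext h)) (fun h => n2 (Subtype.ext h))
      (fun h => n3 (Subtype.ext h)) (fun h => n4 (Subtype.ext h))

end MSProof

/-- No finite `5`-regular matchstick graph exists. -/
theorem no_finite_five_regular_matchstick_graph :
    ¬ ∃ (V : Type) (_ : Fintype V) (_ : Nonempty V) (G : SimpleGraph V)
        (g : V → EuclideanSpace ℝ (Fin 2)),
      (∀ v : V, (G.neighborSet v).ncard = 5) ∧ IsMatchstickEmbedding G g := by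
  rintro ⟨V, hF, hN, G, g, hdeg, hinj, hunit, hseg⟩
  refine MSProof.reduction G g hdeg hinj hunit ?_
  intro i j k l h1 h2 n1 n2 n3 n4
  refine hseg i j k l h1 h2 ?_
  ext x
  simp only [Set.mem_inter_iff, Set.mem_insert_iff, Set.mem_singleton_iff, Set.mem_empty_iff_false,
    iff_false]
  rintro ⟨rfl | rfl, rfl | rfl⟩ <;> contradiction
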